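/- Let ℓ be a prime. There are no integers x ≥ 1 and y such that (x+1)³ + (x+2)³ + (x+3)³ + (x+4)³ + (x+5)³ + (x+6)³ = yˡ. -/

import Mathlib

/-! ### Large exponents: interpolation determinants -/

section LargeExponent

open Finset Polynomial

/-- A matrix with linearly independent columns has a nonzero maximal minor. -/
theorem exists_injective_det_submatrix_ne_zero {ι : Type*} [Fintype ι] {k : ℕ}
    (A : Matrix ι (Fin k) ℝ) (hA : ∀ a : Fin k → ℝ, A.mulVec a = 0 → a = 0) :
    ∃ r : Fin k → ι, Function.Injective r ∧ (A.submatrix r id).det ≠ 0 := by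
  have hrank : A.rank = k := by
    have hinj : Function.Injective A.mulVecLin := by
      rw [← LinearMap.ker_eq_bot, LinearMap.ker_eq_bot']
      intro a ha
      exact hA a ha
    rw [Matrix.rank, LinearMap.finrank_range_of_inj hinj]
    simp
  have hspan : Submodule.span ℝ (Set.range A.row) = ⊤ := by
    apply Submodule.eq_top_of_finrank_eq
    rw [← Matrix.rank_eq_finrank_span_row, hrank]
    simp
  obtain ⟨κ, a, ha, hs, hli⟩ := exists_linearIndependent' ℝ A.row
  let b := Module.Basis.mk hli (by rw [hs, hspan])
  have : Fintype κ := Fintype.ofInjective a ha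
  have hcard : Fintype.card κ = k := by
    rw [← Module.finrank_eq_card_basis b]
    simp
  let e : Fin k ≃ κ := (Fintype.equivFinOfCardEq hcard).symm
  refine ⟨a ∘ e, ha.comp e.injective, ?_⟩
  have h1 : LinearIndependent ℝ (A.submatrix (a ∘ e) id).row :=
    hli.comp e e.injective
  rw [Matrix.linearIndependent_rows_iff_isUnit] at h1
  exact ((Matrix.isUnit_iff_isUnit_det _).1 h1).ne_zero

/-- The determinant of a matrix whose entries are dominated by a rank one matrix. -/
theorem abs_det_le_factorial_mul_prod {k : ℕ} (A : Matrix (Fin k) (Fin k) ℝ) (f g : Fin k → ℝ)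
    (h : ∀ j i, |A j i| ≤ f j * g i) :
    |A.det| ≤ k.factorial * ((∏ j, f j) * ∏ i, g i) := by
  rw [Matrix.det_apply]
  calc |∑ σ : Equiv.Perm (Fin k), Equiv.Perm.sign σ • ∏ i, A (σ i) i|
      ≤ ∑ σ : Equiv.Perm (Fin k), |Equiv.Perm.sign σ • ∏ i, A (σ i) i| := abs_sum_le_sum_abs _ _
    _ ≤ ∑ σ : Equiv.Perm (Fin k), (∏ j, f j) * ∏ i, g i := by
        refine sum_le_sum fun σ _ => ?_
        have h1 : |Equiv.Perm.sign σ • ∏ i, A (σ i) i| = ∏ i, |A (σ i) i| := by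
          rw [← abs_prod]
          rcases Int.units_eq_one_or (Equiv.Perm.sign σ) with h | h <;> simp [h]
        rw [h1]
        calc ∏ i, |A (σ i) i| ≤ ∏ i, f (σ i) * g i :=
              prod_le_prod (fun _ _ => abs_nonneg _) fun i _ => h _ _
          _ = (∏ j, f j) * ∏ i, g i := by
              rw [prod_mul_distrib, Equiv.prod_comp σ f]
    _ = _ := by simp [Fintype.card_perm]

/-- The sequence interpolating `α ^ r * β ^ s` at `r * l + s`. -/
noncomputable def powSeq (α β : ℝ) (l t : ℕ) : ℝ := α ^ (t / l) * β ^ (t % l)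

/-- The `n`-th forward difference at `0` of `t ↦ choose t i * powSeq α β l t`. -/
noncomputable def diffEntry (α β : ℝ) (l n i : ℕ) : ℝ :=
  (fwdDiff 1)^[n] (fun t : ℕ => (t.choose i : ℝ) * powSeq α β l t) 0

theorem diffEntry_eq_sum (α β : ℝ) (l n i : ℕ) :
    diffEntry α β l n i = ∑ t ∈ range (n + 1),
      (-1 : ℝ) ^ (n - t) * n.choose t * (t.choose i * powSeq α β l t) := by
  rw [diffEntry, fwdDiff_iter_eq_sum_shift]
  refine sum_congr rfl fun t _ => ?_
  simp [zsmul_eq_mul]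

/-- The polynomial `t ↦ choose t i`. -/
noncomputable def choosePoly (i : ℕ) : ℝ[X] := C ((i.factorial : ℝ)⁻¹) * descPochhammer ℝ i

theorem eval_choosePoly (i t : ℕ) : (choosePoly i).eval (t : ℝ) = t.choose i := by
  rw [choosePoly, eval_mul, eval_C, descPochhammer_eval_eq_descFactorial,
    Nat.descFactorial_eq_factorial_mul_choose]
  have : (i.factorial : ℝ) ≠ 0 := by exact_mod_cast i.factorial_ne_zero
  push_cast
  field_simp

theorem natDegree_choosePoly_le (i : ℕ) : (choosePoly i).natDegree ≤ i := by
  refine (natDegree_C_mul_le _ _).trans ?_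
  rw [descPochhammer_natDegree]

theorem natDegree_sum_choosePoly_lt {k : ℕ} (hk : 0 < k) (a : ℕ → ℝ) :
    (∑ i ∈ range k, C (a i) * choosePoly i).natDegree < k := by
  have : (∑ i ∈ range k, C (a i) * choosePoly i).natDegree ≤ k - 1 := by
    refine natDegree_sum_le_of_forall_le _ _ fun i hi => ?_
    refine (natDegree_C_mul_le _ _).trans ((natDegree_choosePoly_le i).trans ?_)
    have := mem_range.1 hi
    omega
  omega

theorem eval_sum_choosePoly (k t : ℕ) (a : ℕ → ℝ) :
    (∑ i ∈ range k, C (a i) * choosePoly i).eval (t : ℝ) = ∑ i ∈ range k, a i * t.choose i := by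
  simp [eval_finsetSum, eval_choosePoly]

theorem eq_zero_of_sum_mul_choose_eq_zero {k : ℕ} (a : ℕ → ℝ)
    (h : ∀ t < k, ∑ i ∈ range k, a i * t.choose i = 0) : ∀ t < k, a t = 0 := by
  intro t
  induction t using Nat.strong_induction_on with
  | _ t ih =>
    intro ht
    have h1 := h t ht
    rw [sum_eq_single t] at h1
    · simpa using h1
    · intro i hi hne
      rcases lt_or_gt_of_ne hne with h2 | h2
      · rw [ih i h2 (mem_range.1 hi), zero_mul]
      · rw [Nat.choose_eq_zero_of_lt h2]; simp
    · intro h2; exact absurd (mem_range.2 ht) h2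

theorem powSeq_succ {α β : ℝ} {l t : ℕ} (h : t % l + 1 < l) :
    powSeq α β l (t + 1) = β * powSeq α β l t := by
  have h1 : (t + 1) % l = t % l + 1 := by
    rw [Nat.add_mod, Nat.mod_eq_of_lt (a := 1) (by omega), Nat.mod_eq_of_lt h]
  have h2 : (t + 1) / l = t / l := by
    have e1 := Nat.div_add_mod t l
    have e2 := Nat.div_add_mod (t + 1) l
    rw [h1] at e2
    have : l * ((t + 1) / l) = l * (t / l) := by omega
    exact Nat.eq_of_mul_eq_mul_left (by omega) this
  rw [powSeq, powSeq, h1, h2, pow_succ]; ring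

theorem eq_zero_of_sum_mul_diffEntry_eq_zero {α β : ℝ} (hα : 0 < α) (hβ : 1 < β) {m R : ℕ}
    (hk : 0 < R * m) (a : ℕ → ℝ)
    (h : ∀ n, R * m ≤ n → n < R * (2 * m + 1) →
      ∑ i ∈ range (R * m), a i * diffEntry α β (2 * m + 1) n i = 0) :
    ∀ i < R * m, a i = 0 := by
  set k := R * m with hkdef
  set l := 2 * m + 1 with hl
  set q : ℝ[X] := ∑ i ∈ range k, C (a i) * choosePoly i with hq
  have hR : 0 < R := Nat.pos_of_mul_pos_right hk
  have hm : 0 < m := Nat.pos_of_mul_pos_left hk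
  have hN : R * l = 2 * k + R := by rw [hl, hkdef]; ring
  set g : ℕ → ℝ := fun t => q.eval (t : ℝ) * powSeq α β l t with hg
  have hpos : ∀ t, 0 < powSeq α β l t := fun t => by
    rw [powSeq]; positivity
  have hdiff : ∀ n, (fwdDiff 1)^[n] g 0 = ∑ i ∈ range k, a i * diffEntry α β l n i := by
    intro n
    simp only [diffEntry_eq_sum]
    rw [fwdDiff_iter_eq_sum_shift]
    simp only [mul_sum]
    rw [sum_comm]
    refine sum_congr rfl fun t _ => ?_
    simp only [hg, hq, zero_add, smul_eq_mul, mul_one, eval_sum_choosePoly, zsmul_eq_mul, sum_mul,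
      mul_sum]
    refine sum_congr rfl fun i _ => ?_
    push_cast
    ring
  set p : ℝ[X] := ∑ n ∈ range k, C ((fwdDiff 1)^[n] g 0) * choosePoly n with hp
  have hgp : ∀ t < R * l, g t = p.eval (t : ℝ) := by
    intro t ht
    have h1 := shift_eq_sum_fwdDiff_iter 1 g t 0
    simp only [zero_add, smul_eq_mul, mul_one] at h1
    rw [h1, hp, eval_sum_choosePoly]
    have e1 : ∑ n ∈ range (t + 1), t.choose n • (fwdDiff 1)^[n] g 0
        = ∑ n ∈ range (R * l), (fwdDiff 1)^[n] g 0 * t.choose n := by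
      rw [← sum_subset (range_subset_range.2 (show t + 1 ≤ R * l by omega))]
      · refine sum_congr rfl fun n _ => ?_
        rw [nsmul_eq_mul]; ring
      · intro n _ hn
        rw [mem_range, not_lt] at hn
        rw [Nat.choose_eq_zero_of_lt (by omega)]; simp
    rw [e1]
    symm
    refine sum_subset (range_subset_range.2 (show k ≤ R * l by omega)) ?_
    intro n hn1 hn2
    rw [mem_range] at hn1
    rw [mem_range, not_lt] at hn2
    rw [hdiff, h n hn2 hn1, zero_mul]
  have hqdeg : q.natDegree < k := natDegree_sum_choosePoly_lt hk a
  have hpdeg : p.natDegree < k := natDegree_sum_choosePoly_lt hk _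
  have hF : taylor 1 p * q = C β * (taylor 1 q * p) := by
    rw [← sub_eq_zero]
    set s : Finset ℕ := (range (R * l)).filter (fun t => t % l + 1 < l) with hs
    refine eq_zero_of_natDegree_lt_card_of_eval_eq_zero' _ (s.image (fun t : ℕ => (t : ℝ))) ?_ ?_
    · intro y hy
      obtain ⟨t, ht, rfl⟩ := mem_image.1 hy
      rw [hs, mem_filter, mem_range] at ht
      have ht1 : t + 1 < R * l := by
        have e1 := Nat.div_add_mod t l
        have e2 : t / l < R := Nat.div_lt_of_lt_mul (by rw [mul_comm]; exact ht.1)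
        have e3 : l * (t / l + 1) ≤ l * R := Nat.mul_le_mul_left _ e2
        rw [mul_comm R l]
        rw [mul_add] at e3
        omega
      have h1 := hgp t ht.1
      have h2 := hgp (t + 1) ht1
      rw [hg] at h1 h2
      simp only at h1 h2
      rw [powSeq_succ ht.2] at h2
      push_cast at h2
      simp only [eval_sub, eval_mul, taylor_eval, eval_C]
      rw [← h1, ← h2]
      ring
    · rw [card_image_of_injective _ Nat.cast_injective]
      have hcard : 2 * k ≤ s.card := by
        have : ((range R) ×ˢ (range (2 * m))).card ≤ s.card := by
          refine card_le_card_of_injOn (fun w => l * w.1 + w.2) ?_ ?_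
          · intro w hw
            simp only [coe_product, coe_range, Set.mem_prod, Set.mem_Iio] at hw
            simp only [hs, coe_filter, mem_range, Set.mem_ofPred_eq]
            refine ⟨?_, ?_⟩
            · have : l * (w.1 + 1) ≤ l * R := Nat.mul_le_mul_left _ hw.1
              rw [mul_comm R l]
              rw [mul_add] at this
              omega
            · rw [Nat.mul_add_mod, Nat.mod_eq_of_lt (by omega)]; omega
          · intro w hw w' hw' he
            simp only [coe_product, coe_range, Set.mem_prod, Set.mem_Iio] at hw hw'
            simp only at he
            have e1 : w.2 = w'.2 := by
              have := congrArg (· % l) he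
              simpa [Nat.mul_add_mod, Nat.mod_eq_of_lt (show w.2 < l by omega),
                Nat.mod_eq_of_lt (show w'.2 < l by omega)] using this
            have e2 : w.1 = w'.1 := by
              have : l * w.1 = l * w'.1 := by omega
              exact Nat.eq_of_mul_eq_mul_left (by omega) this
            exact Prod.ext e2 e1
        rw [card_product, card_range, card_range] at this
        calc 2 * k = R * (2 * m) := by rw [hkdef]; ring
          _ ≤ _ := this
      refine lt_of_lt_of_le (lt_of_le_of_lt (natDegree_sub_le _ _) ?_) hcard
      refine max_lt ?_ ?_
      · refine lt_of_le_of_lt natDegree_mul_le ?_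
        rw [natDegree_taylor]; omega
      · refine lt_of_le_of_lt (natDegree_C_mul_le _ _) (lt_of_le_of_lt natDegree_mul_le ?_)
        rw [natDegree_taylor]; omega
  have hq0 : q = 0 := by
    by_contra hq0
    have hp0 : p ≠ 0 := by
      intro hp0
      apply hq0
      refine eq_zero_of_natDegree_lt_card_of_eval_eq_zero' _
        ((range k).image (fun t : ℕ => (t : ℝ))) ?_ ?_
      · intro y hy
        obtain ⟨t, ht, rfl⟩ := mem_image.1 hy
        have h1 := hgp t (by rw [mem_range] at ht; omega)
        rw [hp0, eval_zero] at h1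
        exact (mul_eq_zero.1 h1).resolve_right (hpos t).ne'
      · rw [card_image_of_injective _ Nat.cast_injective, card_range]
        exact hqdeg
    have h1 := congrArg leadingCoeff hF
    simp only [leadingCoeff_mul, leadingCoeff_taylor, leadingCoeff_C] at h1
    have h2 : p.leadingCoeff * q.leadingCoeff ≠ 0 :=
      mul_ne_zero (leadingCoeff_ne_zero.2 hp0) (leadingCoeff_ne_zero.2 hq0)
    have h3 : (β - 1) * (p.leadingCoeff * q.leadingCoeff) = 0 := by linear_combination -h1
    rcases mul_eq_zero.1 h3 with h4 | h4
    · linarith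
    · exact h2 h4
  refine eq_zero_of_sum_mul_choose_eq_zero a fun t _ => ?_
  rw [← eval_sum_choosePoly, ← hq, hq0, eval_zero]

theorem exists_det_diffEntry_ne_zero {α β : ℝ} (hα : 0 < α) (hβ : 1 < β) {m R : ℕ}
    (hk : 0 < R * m) :
    ∃ r : Fin (R * m) → ℕ, Function.Injective r ∧
      (∀ j, R * m ≤ r j ∧ r j < R * (2 * m + 1)) ∧
      (Matrix.of fun j i : Fin (R * m) => diffEntry α β (2 * m + 1) (r j) i).det ≠ 0 := by
  obtain ⟨r, hr, hdet⟩ := exists_injective_det_submatrix_ne_zero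
    (Matrix.of fun (n : Ico (R * m) (R * (2 * m + 1))) (i : Fin (R * m)) =>
      diffEntry α β (2 * m + 1) n.1 i) (by
      intro a ha
      have key := eq_zero_of_sum_mul_diffEntry_eq_zero hα hβ hk
        (fun i => if h : i < R * m then a ⟨i, h⟩ else 0) (by
          intro n hn1 hn2
          have h1 := congrFun ha ⟨n, mem_Ico.2 ⟨hn1, hn2⟩⟩
          rw [Matrix.mulVec, dotProduct] at h1
          rw [← Fin.sum_univ_eq_sum_range (fun i => (if h : i < R * m then a ⟨i, h⟩ else 0) *
            diffEntry α β (2 * m + 1) n i)]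
          simp only [Matrix.of_apply, Pi.zero_apply] at h1
          refine Eq.trans (sum_congr rfl fun i _ => ?_) h1
          rw [dif_pos i.2, mul_comm])
      ext i
      simpa using key i.1 i.2)
  refine ⟨fun j => (r j).1, fun j j' h => hr (Subtype.ext h), fun j => mem_Ico.1 (r j).2, ?_⟩
  exact hdet

theorem sum_range_mul_mod (F : ℕ → ℕ) (R l : ℕ) :
    ∑ t ∈ range (R * l), F (t % l) = R * ∑ s ∈ range l, F s := by
  induction R with
  | zero => simp
  | succ R ih =>
    rw [add_mul, one_mul, sum_range_add, ih, add_mul, one_mul]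
    congr 1
    refine sum_congr rfl fun s hs => ?_
    rw [mul_comm, Nat.mul_add_mod, Nat.mod_eq_of_lt (mem_range.1 hs)]

theorem sum_range_sub_center (m : ℕ) :
    ∑ s ∈ range (2 * m + 1), (s - m) = (m + 1).choose 2 := by
  rw [show 2 * m + 1 = m + (m + 1) by ring, sum_range_add, sum_eq_zero, zero_add]
  · simp only [add_tsub_cancel_left]
    rw [Finset.sum_range_id, Nat.choose_two_right]
  · intro s hs
    have := mem_range.1 hs
    omega

theorem sum_range_center_sub (m : ℕ) :
    ∑ s ∈ range (2 * m + 1), (m - s) = (m + 1).choose 2 := by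
  rw [← sum_range_sub_center, ← sum_range_reflect]
  refine sum_congr rfl fun s hs => ?_
  have := mem_range.1 hs
  omega

theorem sum_mod_bounds {m R : ℕ} (f : Fin (R * m) → Fin (R * (2 * m + 1)))
    (hf : Function.Injective f) :
    R * m.choose 2 ≤ ∑ j, (f j : ℕ) % (2 * m + 1) ∧
      ∑ j, (f j : ℕ) % (2 * m + 1) ≤ R * (m * m + (m + 1).choose 2) := by
  have hsum : ∀ F : ℕ → ℕ, ∑ j, F ((f j : ℕ) % (2 * m + 1)) ≤ R * ∑ s ∈ range (2 * m + 1), F s := by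
    intro F
    rw [← sum_range_mul_mod, ← Fin.sum_univ_eq_sum_range (fun t => F (t % (2 * m + 1)))]
    rw [← sum_image (f := fun t : Fin (R * (2 * m + 1)) => F ((t : ℕ) % (2 * m + 1)))
      (s := univ) (g := f)
      (fun a _ b _ h => hf h)]
    exact sum_le_sum_of_subset (subset_univ _)
  have hm2 : m.choose 2 + (m + 1).choose 2 = m * m := by
    rw [show (m + 1).choose 2 = m + m.choose 2 by
      rw [Nat.choose_succ_succ' m 1, Nat.choose_one_right]]
    have := Nat.choose_two_right m
    have h2 : m * (m - 1) % 2 = 0 := by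
      rcases Nat.even_or_odd m with h | h
      · exact Nat.even_iff.1 (h.mul_right _)
      · exact Nat.even_iff.1 ((Nat.Odd.sub_odd h odd_one).mul_left _)
    have h3 : m * (m - 1) + m = m * m := by
      cases m with
      | zero => rfl
      | succ m => simp; ring
    omega
  constructor
  · have h1 := hsum (fun s => m - s)
    rw [sum_range_center_sub] at h1
    have h2 : R * m * m ≤ ∑ j, (f j : ℕ) % (2 * m + 1) + ∑ j, (m - (f j : ℕ) % (2 * m + 1)) := by
      rw [← sum_add_distrib]
      calc R * m * m = ∑ _j : Fin (R * m), m := by simp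
        _ ≤ _ := sum_le_sum fun j _ => by omega
    have h3 : R * m.choose 2 + R * (m + 1).choose 2 = R * m * m := by
      rw [← mul_add, hm2, mul_assoc]
    omega
  · have h1 := hsum (fun s => s - m)
    rw [sum_range_sub_center] at h1
    have h2 : ∑ j, (f j : ℕ) % (2 * m + 1) ≤ R * m * m + ∑ j, ((f j : ℕ) % (2 * m + 1) - m) := by
      calc ∑ j, (f j : ℕ) % (2 * m + 1) ≤ ∑ j, (m + ((f j : ℕ) % (2 * m + 1) - m)) :=
            sum_le_sum fun j _ => by omega
        _ = _ := by rw [sum_add_distrib]; simp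
    have h3 : R * (m * m + (m + 1).choose 2) = R * m * m + R * (m + 1).choose 2 := by ring
    omega

theorem pow_le_abs_det_diffEntry_mul {P Q X Y m R : ℕ} (hQ : 0 < Q) (hX : 0 < X)
    (r : Fin (R * m) → ℕ) (hr : ∀ j, r j < R * (2 * m + 1))
    (hdet : (Matrix.of fun j i : Fin (R * m) =>
      diffEntry (P / Q : ℝ) (Y / X : ℝ) (2 * m + 1) (r j) i).det ≠ 0) :
    (Y : ℝ) ^ (R * m.choose 2) ≤ |(Matrix.of fun j i : Fin (R * m) =>
      diffEntry (P / Q : ℝ) (Y / X : ℝ) (2 * m + 1) (r j) i).det| *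
        ((Q : ℝ) ^ (R * m * R) * (X : ℝ) ^ (R * (m * m + (m + 1).choose 2))) := by
  set A := Matrix.of fun j i : Fin (R * m) =>
    diffEntry (P / Q : ℝ) (Y / X : ℝ) (2 * m + 1) (r j) i with hA
  set c : Fin (R * m) → Fin (R * (2 * m + 1)) → ℤ :=
    fun j t => (-1) ^ (r j - (t : ℕ)) * ((r j).choose t : ℤ) with hc
  have hA' : A = fun j => ∑ t : Fin (R * (2 * m + 1)),
      ((c j t : ℝ) * powSeq (P / Q : ℝ) (Y / X : ℝ) (2 * m + 1) t) •
        (fun i : Fin (R * m) => (((t : ℕ).choose i : ℕ) : ℝ)) := by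
    funext j i
    rw [hA, Matrix.of_apply, diffEntry_eq_sum, Finset.sum_apply]
    simp only [Pi.smul_apply, smul_eq_mul, hc]
    rw [Fin.sum_univ_eq_sum_range (fun t => (((-1) ^ (r j - t) * ((r j).choose t : ℤ) : ℤ) : ℝ) *
      powSeq (P / Q : ℝ) (Y / X : ℝ) (2 * m + 1) t * (t.choose i : ℝ)) (R * (2 * m + 1))]
    rw [← sum_subset (range_subset_range.2 (show r j + 1 ≤ R * (2 * m + 1) from hr j))]
    · refine sum_congr rfl fun t _ => ?_
      push_cast
      ring
    · intro t _ ht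
      rw [mem_range, not_lt] at ht
      rw [Nat.choose_eq_zero_of_lt (by omega)]
      simp
  have hexp : A.det = ∑ f : Fin (R * m) → Fin (R * (2 * m + 1)),
      (∏ j, ((c j (f j) : ℝ) * powSeq (P / Q : ℝ) (Y / X : ℝ) (2 * m + 1) (f j))) *
        (Matrix.of fun j i : Fin (R * m) => (((f j : ℕ).choose i : ℕ) : ℝ)).det := by
    have h1 : A.det = Matrix.detRowAlternating.toMultilinearMap A := rfl
    rw [h1, hA', MultilinearMap.map_sum]
    refine sum_congr rfl fun f _ => ?_
    rw [MultilinearMap.map_smul_univ]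
    rfl
  have hintegral : ∃ z : ℤ, A.det * ((Q : ℝ) ^ (R * m * R) * (X : ℝ) ^ (R * (m * m + (m + 1).choose 2)))
      = (Y : ℝ) ^ (R * m.choose 2) * z := by
    rw [hexp, sum_mul]
    have hterm : ∀ f : Fin (R * m) → Fin (R * (2 * m + 1)), ∃ z : ℤ,
        (∏ j, ((c j (f j) : ℝ) * powSeq (P / Q : ℝ) (Y / X : ℝ) (2 * m + 1) (f j))) *
        (Matrix.of fun j i : Fin (R * m) => (((f j : ℕ).choose i : ℕ) : ℝ)).det *
        ((Q : ℝ) ^ (R * m * R) * (X : ℝ) ^ (R * (m * m + (m + 1).choose 2)))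
          = (Y : ℝ) ^ (R * m.choose 2) * z := by
      intro f
      by_cases hf : Function.Injective f
      · obtain ⟨h1, h2⟩ := sum_mod_bounds f hf
        set σ := ∑ j, (f j : ℕ) % (2 * m + 1) with hσ
        set a := ∑ j, (f j : ℕ) / (2 * m + 1) with ha
        have h3 : a ≤ R * m * R := by
          calc a ≤ ∑ _j : Fin (R * m), R := sum_le_sum fun j _ => by
                refine (Nat.div_lt_of_lt_mul ?_).le
                exact (f j).2.trans_eq (mul_comm _ _)
            _ = R * m * R := by simp
        have hv : ∏ j, powSeq (P / Q : ℝ) (Y / X : ℝ) (2 * m + 1) (f j)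
            = (P / Q : ℝ) ^ a * (Y / X : ℝ) ^ σ := by
          simp only [powSeq, prod_mul_distrib, prod_pow_eq_pow_sum, ha, hσ]
        have hd : (Matrix.of fun j i : Fin (R * m) => (((f j : ℕ).choose i : ℕ) : ℝ)).det
            = ((Matrix.of fun j i : Fin (R * m) => (((f j : ℕ).choose i : ℕ) : ℤ)).det : ℤ) := by
          rw [Int.cast_det]
          congr 1
        obtain ⟨e1, he1⟩ := Nat.exists_eq_add_of_le h1
        obtain ⟨e2, he2⟩ := Nat.exists_eq_add_of_le h2
        obtain ⟨e3, he3⟩ := Nat.exists_eq_add_of_le h3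
        refine ⟨(∏ j, c j (f j)) * (Matrix.of fun j i : Fin (R * m) =>
          (((f j : ℕ).choose i : ℕ) : ℤ)).det * (P ^ a * Q ^ e3 * Y ^ e1 * X ^ e2), ?_⟩
        have hQ' : (Q : ℝ) ≠ 0 := by positivity
        have hX' : (X : ℝ) ≠ 0 := by positivity
        rw [prod_mul_distrib, hv, hd, he2, he3, pow_add, pow_add, div_pow, div_pow]
        have hY : (Y : ℝ) ^ σ = (Y : ℝ) ^ (R * m.choose 2) * Y ^ e1 := by rw [he1, pow_add]
        rw [hY]
        push_cast
        field_simp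
      · refine ⟨0, ?_⟩
        rw [Function.Injective] at hf
        push Not at hf
        obtain ⟨j, j', h1, h2⟩ := hf
        rw [Matrix.det_zero_of_row_eq h2]
        · simp
        · funext i
          simp [h1]
    choose z hz using hterm
    refine ⟨∑ f, z f, ?_⟩
    rw [sum_congr rfl fun f _ => hz f, ← mul_sum]
    push_cast
    rfl
  obtain ⟨z, hz⟩ := hintegral
  have hpos : (0 : ℝ) < (Q : ℝ) ^ (R * m * R) * (X : ℝ) ^ (R * (m * m + (m + 1).choose 2)) := by
    positivity
  have hz0 : z ≠ 0 := by
    rintro rfl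
    rw [Int.cast_zero, mul_zero] at hz
    exact (mul_ne_zero hdet hpos.ne') hz
  rw [← abs_of_pos hpos, ← abs_mul, hz, abs_mul, abs_of_nonneg (by positivity)]
  refine le_mul_of_one_le_right (by positivity) ?_
  rw [← Int.cast_abs]
  exact_mod_cast Int.one_le_abs hz0

theorem sum_alternating_choose_mul_choose_mul_pow (β : ℝ) {n i : ℕ} (hi : i ≤ n) :
    ∑ t ∈ range (n + 1), (-1 : ℝ) ^ (n - t) * n.choose t * (t.choose i * β ^ t)
      = n.choose i * ((β - 1) ^ (n - i) * β ^ i) := by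
  obtain ⟨d, rfl⟩ := Nat.exists_eq_add_of_le hi
  rw [show i + d + 1 = i + (d + 1) by ring, sum_range_add, sum_eq_zero, zero_add]
  · rw [add_tsub_cancel_left, sub_eq_add_neg, add_pow, sum_mul, mul_sum]
    refine sum_congr rfl fun s hs => ?_
    have hs' := mem_range.1 hs
    have h := Nat.choose_mul (n := i + d) (k := i + s) (s := i) (by omega)
    rw [show i + d - i = d by omega, show i + s - i = s by omega] at h
    have h' : ((i + d).choose (i + s) : ℝ) * (i + s).choose i = (i + d).choose i * d.choose s := by
      exact_mod_cast h
    rw [show i + d - (i + s) = d - s by omega, pow_add]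
    linear_combination ((-1 : ℝ) ^ (d - s) * β ^ i * β ^ s) * h'
  · intro t ht
    rw [Nat.choose_eq_zero_of_lt (mem_range.1 ht)]
    simp

theorem sum_choose_mul_choose {n i : ℕ} (hi : i ≤ n) :
    ∑ t ∈ range (n + 1), (n.choose t : ℝ) * t.choose i = n.choose i * 2 ^ (n - i) := by
  obtain ⟨d, rfl⟩ := Nat.exists_eq_add_of_le hi
  rw [show i + d + 1 = i + (d + 1) by ring, sum_range_add, sum_eq_zero, zero_add]
  · rw [add_tsub_cancel_left]
    have h2 : (2 : ℝ) ^ d = ∑ s ∈ range (d + 1), (d.choose s : ℝ) := by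
      exact_mod_cast (Nat.sum_range_choose d).symm
    rw [h2, mul_sum]
    refine sum_congr rfl fun s hs => ?_
    have hs' := mem_range.1 hs
    have h := Nat.choose_mul (n := i + d) (k := i + s) (s := i) (by omega)
    rw [show i + d - i = d by omega, show i + s - i = s by omega] at h
    exact_mod_cast h
  · intro t ht
    rw [Nat.choose_eq_zero_of_lt (mem_range.1 ht)]
    simp

theorem powSeq_sub_pow_bounds {α β κ : ℝ} {l R t : ℕ} (hβ : 1 ≤ β) (hκ : 0 ≤ κ)
    (hα : α = β ^ l + κ) (ht : t < R * l) :
    0 ≤ powSeq α β l t - β ^ t ∧ powSeq α β l t - β ^ t ≤ R * κ * α ^ R := by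
  have hl : 0 < l := Nat.pos_of_ne_zero (by rintro rfl; simp at ht)
  have hβl : 1 ≤ β ^ l := one_le_pow₀ hβ
  have hα1 : 1 ≤ α := by linarith
  have hle : β ^ l ≤ α := by linarith
  have hq : t / l < R := Nat.div_lt_of_lt_mul (by rwa [mul_comm])
  have hdecomp : β ^ t = (β ^ l) ^ (t / l) * β ^ (t % l) := by
    rw [← pow_mul, ← pow_add, Nat.div_add_mod]
  rw [hdecomp, powSeq, ← sub_mul]
  have hs : β ^ (t % l) ≤ α := (pow_le_pow_right₀ hβ (Nat.mod_lt _ hl).le).trans hle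
  have hs0 : 0 ≤ β ^ (t % l) := by positivity
  have h0 : 0 ≤ α ^ (t / l) - (β ^ l) ^ (t / l) :=
    sub_nonneg.2 (pow_le_pow_left₀ (by positivity) hle _)
  refine ⟨mul_nonneg h0 hs0, ?_⟩
  have key : ∀ q : ℕ, (α ^ q - (β ^ l) ^ q) * α ≤ q * κ * α ^ q := by
    intro q
    induction q with
    | zero => simp
    | succ q ih =>
      have h1 : (β ^ l) ^ q ≤ α ^ q := pow_le_pow_left₀ (by positivity) hle _
      have e : (α ^ (q + 1) - (β ^ l) ^ (q + 1)) * α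
          = ((α ^ q - (β ^ l) ^ q) * α) * α + κ * (β ^ l) ^ q * α := by
        rw [pow_succ, pow_succ]
        linear_combination ((β ^ l) ^ q * α) * hα
      rw [e]
      have h2 := mul_le_mul_of_nonneg_right ih (show 0 ≤ α by linarith)
      have h3 : κ * (β ^ l) ^ q * α ≤ κ * α ^ q * α := by gcongr
      push_cast
      calc _ ≤ q * κ * α ^ q * α + κ * α ^ q * α := add_le_add h2 h3
        _ = _ := by ring
  calc _ ≤ (α ^ (t / l) - (β ^ l) ^ (t / l)) * α := mul_le_mul_of_nonneg_left hs h0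
    _ ≤ (t / l : ℕ) * κ * α ^ (t / l) := key _
    _ ≤ R * κ * α ^ R := by
        gcongr

theorem abs_diffEntry_le {α β κ : ℝ} {l R n i : ℕ} (hβ : 1 ≤ β) (hκ : 0 ≤ κ)
    (hα : α = β ^ l + κ) (hn : n < R * l) (hi : i ≤ n) :
    |diffEntry α β l n i| ≤ n.choose i * (α ^ R * ((β - 1) ^ (n - i) + R * κ * 2 ^ (n - i))) := by
  have hβl : 1 ≤ β ^ l := one_le_pow₀ hβ
  have hsplit : diffEntry α β l n i = n.choose i * ((β - 1) ^ (n - i) * β ^ i)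
      + ∑ t ∈ range (n + 1), (-1 : ℝ) ^ (n - t) * n.choose t *
        (t.choose i * (powSeq α β l t - β ^ t)) := by
    rw [diffEntry_eq_sum, ← sum_alternating_choose_mul_choose_mul_pow β hi, ← sum_add_distrib]
    refine sum_congr rfl fun t _ => ?_
    ring
  have herr : |∑ t ∈ range (n + 1), (-1 : ℝ) ^ (n - t) * n.choose t *
        (t.choose i * (powSeq α β l t - β ^ t))| ≤ n.choose i * 2 ^ (n - i) * (R * κ * α ^ R) := by
    rw [← sum_choose_mul_choose hi, sum_mul]
    refine (abs_sum_le_sum_abs _ _).trans (sum_le_sum fun t ht => ?_)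
    obtain ⟨h1, h2⟩ := powSeq_sub_pow_bounds hβ hκ hα
      (lt_of_le_of_lt (Nat.lt_succ_iff.1 (mem_range.1 ht)) hn)
    rw [abs_mul, abs_mul, abs_mul, abs_pow, abs_neg, abs_one, one_pow, one_mul, Nat.abs_cast,
      Nat.abs_cast, abs_of_nonneg h1, ← mul_assoc]
    gcongr
  have hβi : β ^ i ≤ α ^ R := by
    calc β ^ i ≤ β ^ (l * R) := pow_le_pow_right₀ hβ (by rw [mul_comm]; omega)
      _ = (β ^ l) ^ R := pow_mul _ _ _
      _ ≤ α ^ R := pow_le_pow_left₀ (by positivity) (by linarith) _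
  have hb1 : 0 ≤ β - 1 := by linarith
  rw [hsplit]
  refine (abs_add_le _ _).trans ?_
  rw [abs_of_nonneg (by positivity)]
  calc _ ≤ n.choose i * ((β - 1) ^ (n - i) * α ^ R) + n.choose i * 2 ^ (n - i) * (R * κ * α ^ R) := by
        refine add_le_add ?_ herr
        gcongr
    _ = _ := by ring

theorem abs_diffEntry_le_mul {α β κ K u X : ℝ} {l R n i a b : ℕ} (hu : 1 ≤ u) (hX : 1 ≤ X)
    (hβ : β = 1 + 2 / u) (hκ : 0 ≤ κ) (hκK : κ * X ^ l ≤ K) (hK : 1 ≤ K)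
    (hα : α = β ^ l + κ) (hn : n < R * l) (hi : i ≤ n) (hab : u ^ a ≤ X ^ l * u ^ b) :
    |diffEntry α β l n i| ≤
      (2 * (K * R * α ^ R) * 3 ^ n / u ^ min n a) * u ^ max i b := by
  have hu0 : 0 < u := by linarith
  have hβ1 : 1 ≤ β := by rw [hβ]; have : 0 ≤ 2 / u := by positivity
                         linarith
  have hα0 : 0 ≤ α := by rw [hα]; positivity
  have hR : 1 ≤ (R : ℝ) := by
    have : R ≠ 0 := by rintro rfl; simp at hn
    exact_mod_cast Nat.one_le_iff_ne_zero.2 this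
  refine (abs_diffEntry_le hβ1 hκ hα hn hi).trans ?_
  have hc : (n.choose i : ℝ) * 2 ^ (n - i) ≤ 3 ^ n := by
    have h := add_pow (1 : ℝ) 2 n
    have h3 : (1 : ℝ) + 2 = 3 := by norm_num
    rw [h3] at h
    rw [h]
    have := single_le_sum (f := fun m => (1 : ℝ) ^ m * 2 ^ (n - m) * (n.choose m))
      (fun j _ => by positivity) (mem_range.2 (Nat.lt_succ_of_le hi))
    calc _ = (1 : ℝ) ^ i * 2 ^ (n - i) * (n.choose i) := by ring
      _ ≤ _ := this
  have h1 : (u ^ (n - i))⁻¹ ≤ u ^ max i b / u ^ min n a := by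
    rw [inv_eq_one_div, div_le_div_iff₀ (by positivity) (by positivity), one_mul, ← pow_add]
    exact pow_le_pow_right₀ hu (by omega)
  have h2 : (X ^ l)⁻¹ ≤ u ^ max i b / u ^ min n a := by
    rw [inv_eq_one_div, div_le_div_iff₀ (by positivity) (by positivity), one_mul]
    calc u ^ min n a ≤ u ^ a := pow_le_pow_right₀ hu (by omega)
      _ ≤ X ^ l * u ^ b := hab
      _ ≤ X ^ l * u ^ max i b := by gcongr; exact le_max_right _ _
      _ = _ := mul_comm _ _
  have hκ' : κ ≤ K * (X ^ l)⁻¹ := by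
    rw [← div_eq_mul_inv, le_div_iff₀ (by positivity)]; exact hκK
  have hKR : 1 ≤ K * R := by nlinarith
  calc (n.choose i : ℝ) * (α ^ R * ((β - 1) ^ (n - i) + R * κ * 2 ^ (n - i)))
      = (n.choose i * 2 ^ (n - i)) * (α ^ R * ((u ^ (n - i))⁻¹ + R * κ)) := by
        rw [show β - 1 = 2 * u⁻¹ by rw [hβ, div_eq_mul_inv]; ring, mul_pow, inv_pow]; ring
    _ ≤ 3 ^ n * (α ^ R * (K * R * (u ^ max i b / u ^ min n a)
          + R * (K * (u ^ max i b / u ^ min n a)))) := by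
        gcongr
        · calc _ ≤ u ^ max i b / u ^ min n a := h1
            _ ≤ _ := le_mul_of_one_le_left (by positivity) hKR
        · exact hκ'.trans (by gcongr)
    _ = _ := by ring

theorem sum_comp_le_of_injective {k N : ℕ} (F : ℕ → ℕ) (r : Fin k → ℕ)
    (hr : Function.Injective r) (h : ∀ j, k ≤ r j ∧ r j < N) :
    ∑ j, F (r j) ≤ ∑ n ∈ Ico k N, F n := by
  rw [← sum_image (f := F) (s := univ) (g := r) (fun a _ b _ h => hr h)]
  refine sum_le_sum_of_subset fun n hn => ?_
  obtain ⟨j, -, rfl⟩ := mem_image.1 hn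
  exact mem_Ico.2 (h j)

theorem two_mul_sum_range_sub_add {k b : ℕ} :
    2 * ∑ i ∈ range k, (i - b) + (k - b) = (k - b) * (k - b) := by
  induction k with
  | zero => simp
  | succ k ih =>
    rw [sum_range_succ, mul_add]
    rcases le_or_gt b k with h | h
    · obtain ⟨d, rfl⟩ := Nat.exists_eq_add_of_le h
      rw [show b + d + 1 - b = d + 1 by omega]
      rw [show b + d - b = d by omega] at ih ⊢
      nlinarith
    · rw [show k - b = 0 by omega] at ih
      rw [show k - b = 0 by omega, show k + 1 - b = 0 by omega]
      omega

theorem two_mul_sum_range_const_sub_le (k e : ℕ) :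
    2 * ∑ i ∈ range k, (e - i) ≤ e * (e + 1) := by
  induction k generalizing e with
  | zero => simp
  | succ k ih =>
    rw [sum_range_succ']
    rcases e with _ | e
    · simp
    · have := ih e
      simp only [Nat.add_sub_add_right, Nat.sub_zero]
      nlinarith

theorem two_mul_sum_le {k R : ℕ} (r : Fin k → ℕ) (hr : Function.Injective r)
    (h : ∀ j, k ≤ r j ∧ r j < 2 * k + R) :
    2 * ∑ j, r j ≤ 3 * (k * k) + 2 * (k * R) := by
  have h1 := sum_comp_le_of_injective (fun n => n - (k + R)) r hr h
  have h2 : ∑ n ∈ Ico k (2 * k + R), (n - (k + R)) ≤ ∑ n ∈ range (2 * k + R), (n - (k + R)) :=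
    sum_le_sum_of_subset fun n hn => mem_range.2 (mem_Ico.1 hn).2
  have h3 := two_mul_sum_range_sub_add (k := 2 * k + R) (b := k + R)
  rw [show 2 * k + R - (k + R) = k by omega] at h3
  have h4 : ∑ j, r j ≤ k * (k + R) + ∑ j, (r j - (k + R)) := by
    calc ∑ j, r j ≤ ∑ j, ((k + R) + (r j - (k + R))) := sum_le_sum fun j _ => by omega
      _ = _ := by rw [sum_add_distrib]; simp
  rw [mul_add] at h4
  omega

theorem sum_max_add_le_sum_min_add {k R c : ℕ} (hc : c ≤ k) (hR : R + 1 ≤ 2 * c) (r : Fin k → ℕ)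
    (hr : Function.Injective r) (h : ∀ j, k ≤ r j ∧ r j < 2 * k + R) :
    ∑ i : Fin k, max (i : ℕ) c + k * k ≤ ∑ j, min (r j) (2 * k + R - c) + c * c := by
  obtain ⟨e, rfl⟩ := Nat.exists_eq_add_of_le hc
  rw [show 2 * (c + e) + R - c = (c + e) + (e + R) by omega]
  have h1 := sum_comp_le_of_injective (fun n => (c + e) + (e + R) - n) r hr h
  rw [sum_Ico_eq_sum_range] at h1
  simp only [Nat.add_sub_add_left] at h1
  have h2 := two_mul_sum_range_const_sub_le (2 * (c + e) + R - (c + e)) (e + R)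
  have h3 : (c + e) * ((c + e) + (e + R)) ≤ ∑ j, min (r j) ((c + e) + (e + R))
      + ∑ j, ((c + e) + (e + R) - r j) := by
    rw [← sum_add_distrib]
    calc _ = ∑ _j : Fin (c + e), ((c + e) + (e + R)) := by simp
      _ ≤ _ := sum_le_sum fun j _ => by omega
  have h4 : ∑ i : Fin (c + e), max (i : ℕ) c = (c + e) * c + ∑ i ∈ range (c + e), (i - c) := by
    rw [Fin.sum_univ_eq_sum_range (fun i => max i c)]
    calc _ = ∑ i ∈ range (c + e), (c + (i - c)) := sum_congr rfl fun i _ => by omega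
      _ = _ := by rw [sum_add_distrib]; simp
  have h5 := two_mul_sum_range_sub_add (k := c + e) (b := c)
  rw [show c + e - c = e by omega] at h5
  have h6 : R * (R + 1) ≤ R * (2 * c) := Nat.mul_le_mul_left _ hR
  nlinarith

theorem log_inequality_of_pow_near {P Q X Y m R c : ℕ} {u K κ : ℝ} (hQ : 0 < Q)
    (hX : 0 < X) (hXY : X < Y) (hm : 0 < m) (hR0 : 0 < R) (hu : 1 ≤ u)
    (hβ : (Y / X : ℝ) = 1 + 2 / u) (hκ : 0 ≤ κ) (hκK : κ * (X : ℝ) ^ (2 * m + 1) ≤ K) (hK : 1 ≤ K)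
    (hα : (P / Q : ℝ) = (Y / X : ℝ) ^ (2 * m + 1) + κ) (hck : c ≤ R * m) (hR : R + 1 ≤ 2 * c)
    (hc : u ^ (2 * (R * m) + R - c) ≤ (X : ℝ) ^ (2 * m + 1) * u ^ c) :
    (((R * m : ℕ) : ℝ) ^ 2 - (c : ℝ) ^ 2) * Real.log u ≤
      (R * m : ℕ) * Real.log (R * m : ℕ) +
      (R * m : ℕ) * Real.log (2 * (K * R * (P / Q : ℝ) ^ R)) +
      (3 / 2 * ((R * m : ℕ) : ℝ) ^ 2 + (R * m : ℕ) * R) * Real.log 3 +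
      (R * m : ℕ) * R * Real.log Q + (R * m : ℕ) * (m + 1) * Real.log X := by
  have hX' : (1 : ℝ) ≤ X := by exact_mod_cast hX
  have hY' : (0 : ℝ) < Y := by exact_mod_cast hX.trans hXY
  have hu0 : 0 < u := by linarith
  have hβ1 : (1 : ℝ) < Y / X := by rw [hβ]; have : 0 < 2 / u := by positivity
                                   linarith
  have hα0 : (0 : ℝ) < P / Q := by rw [hα]; positivity
  have hk : 0 < R * m := Nat.mul_pos hR0 hm
  obtain ⟨r, hr, hrange, hdet⟩ := exists_det_diffEntry_ne_zero hα0 hβ1 hk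
  have hN : R * (2 * m + 1) = 2 * (R * m) + R := by ring
  have hlow := pow_le_abs_det_diffEntry_mul hQ hX r (fun j => (hrange j).2) hdet
  have hup := abs_det_le_factorial_mul_prod (Matrix.of fun j i : Fin (R * m) =>
      diffEntry (P / Q : ℝ) (Y / X : ℝ) (2 * m + 1) (r j) i)
      (fun j => 2 * (K * R * (P / Q : ℝ) ^ R) * 3 ^ (r j) / u ^ min (r j) (2 * (R * m) + R - c))
      (fun i => u ^ max (i : ℕ) c) (fun j i => by
        rw [Matrix.of_apply]
        exact abs_diffEntry_le_mul hu hX' hβ hκ hκK hK hα (hrange j).2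
          (i.2.le.trans (hrange j).1) hc)
  have hrange' : ∀ j, R * m ≤ r j ∧ r j < 2 * (R * m) + R := fun j => by
    rw [← hN]; exact hrange j
  have hs1 := two_mul_sum_le r hr hrange'
  have hs2 := sum_max_add_le_sum_min_add hck hR r hr hrange'
  generalize (Matrix.of fun j i : Fin (R * m) =>
      diffEntry (P / Q : ℝ) (Y / X : ℝ) (2 * m + 1) (r j) i).det = Δ at hdet hlow hup
  rw [prod_div_distrib, prod_mul_distrib, prod_pow_eq_pow_sum, prod_pow_eq_pow_sum,
    prod_pow_eq_pow_sum, prod_const, card_univ, Fintype.card_fin] at hup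
  set H := 2 * (K * R * (P / Q : ℝ) ^ R) with hH
  have hHpos : 0 < H := by positivity
  set S1 := ∑ j, r j
  set S2 := ∑ j, min (r j) (2 * (R * m) + R - c)
  set S3 := ∑ i : Fin (R * m), max (i : ℕ) c
  set k := R * m with hkdef
  have hlogu : 0 ≤ Real.log u := Real.log_nonneg hu
  have hlogX : Real.log X ≤ Real.log Y :=
    Real.log_le_log (by positivity) (by exact_mod_cast hXY.le)
  have hfac : Real.log k.factorial ≤ k * Real.log k := by
    rw [← Real.log_pow]
    exact Real.log_le_log (by positivity) (by exact_mod_cast Nat.factorial_le_pow k)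
  have hl1 := Real.log_le_log (by positivity) hlow
  have hl2 := Real.log_le_log (abs_pos.2 hdet) hup
  have hQ' : (Q : ℝ) ≠ 0 := by positivity
  have hX0 : (X : ℝ) ≠ 0 := by positivity
  have hf0 : (k.factorial : ℝ) ≠ 0 := by positivity
  rw [Real.log_mul (abs_pos.2 hdet).ne' (by positivity), Real.log_mul (by positivity)
    (by positivity), Real.log_pow, Real.log_pow, Real.log_pow] at hl1
  rw [Real.log_mul hf0 (by positivity), Real.log_mul (by positivity) (by positivity),
    Real.log_div (by positivity) (by positivity), Real.log_mul (by positivity) (by positivity),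
    Real.log_pow, Real.log_pow, Real.log_pow, Real.log_pow] at hl2
  have e1 : (R * m.choose 2 : ℕ) * Real.log X ≤ (R * m.choose 2 : ℕ) * Real.log Y := by gcongr
  have hs1' : (S1 : ℝ) ≤ 3 / 2 * (k : ℝ) ^ 2 + k * R := by
    have : (2 * S1 : ℝ) ≤ 3 * (k * k) + 2 * (k * R) := by exact_mod_cast hs1
    nlinarith
  have hs2' : (S3 : ℝ) + (k : ℝ) ^ 2 ≤ S2 + (c : ℝ) ^ 2 := by
    rw [sq, sq]; exact_mod_cast hs2
  have e2 : S1 * Real.log 3 ≤ (3 / 2 * (k : ℝ) ^ 2 + k * R) * Real.log 3 :=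
    mul_le_mul_of_nonneg_right hs1' (Real.log_nonneg (by norm_num))
  have e3 := mul_le_mul_of_nonneg_right hs2' hlogu
  have e4 : ((R * (m * m + (m + 1).choose 2) : ℕ) : ℝ) = (R * m.choose 2 : ℕ) + k * (m + 1) := by
    have : (m + 1).choose 2 = m + m.choose 2 := by
      rw [Nat.choose_succ_succ' m 1, Nat.choose_one_right]
    rw [this, hkdef]
    push_cast
    ring
  rw [e4] at hl1
  have e5 : ((k * R : ℕ) : ℝ) = k * R := by push_cast; rfl
  rw [e5] at hl1
  linarith

theorem quadratic_gap {R m y c k : ℝ} (hk : k = R * m) (hR : 2 ≤ R) (hm : 4500 ≤ m)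
    (hy1 : 2 / 5 * R ≤ y) (hy2 : y ≤ 3 / 5 * R) (hc0 : 0 ≤ c)
    (hc : c ≤ (2 * m + 1) * (R - y) / 2 + 1) :
    0.2375 * k ^ 2 ≤ k ^ 2 - c ^ 2 - k * (m + 1) * y := by
  have hRk : R ≤ k / 4500 := by rw [hk]; nlinarith
  have hk0 : 0 < k := by rw [hk]; positivity
  set w := m * y with hw
  have hw1 : 2 / 5 * k ≤ w := by rw [hk, hw]; nlinarith
  have hw2 : w ≤ 3 / 5 * k := by rw [hk, hw]; nlinarith
  have hc' : c ≤ k - w + 0.00018 * k := by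
    have : (2 * m + 1) * (R - y) / 2 + 1 = k - w + (R - y) / 2 + 1 := by rw [hk, hw]; ring
    rw [this] at hc
    linarith
  have hc2 : c ^ 2 ≤ (k - w + 0.00018 * k) ^ 2 := pow_le_pow_left₀ hc0 hc' 2
  have e1 : k * (m + 1) * y = k * w + k * y := by rw [hw]; ring
  have e2 : k * y ≤ k * (0.00014 * k) := by
    refine mul_le_mul_of_nonneg_left ?_ hk0.le
    linarith
  have e3 : 0 ≤ (w - 2 / 5 * k) * (3 / 5 * k - w) := mul_nonneg (by linarith) (by linarith)
  rw [e1]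
  nlinarith

theorem log_three_le : Real.log 3 ≤ 1.1 := by
  have h : Real.log (3 ^ 10) ≤ 11 := by
    rw [Real.log_le_iff_le_exp (by norm_num), show (11 : ℝ) = (11 : ℕ) by norm_num,
      ← Real.exp_one_pow]
    calc (3 : ℝ) ^ 10 ≤ 2.7182 ^ 11 := by norm_num
      _ ≤ _ := by gcongr; linarith [Real.exp_one_gt_d9]
  rw [Real.log_pow] at h
  push_cast at h
  linarith

theorem log_le_fifteen {a : ℝ} (ha0 : 0 < a) (ha : a ≤ 1543500) : Real.log a ≤ 15 := by
  rw [Real.log_le_iff_le_exp ha0, show (15 : ℝ) = (15 : ℕ) by norm_num, ← Real.exp_one_pow]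
  calc a ≤ 2.7 ^ 15 := ha.trans (by norm_num)
    _ ≤ _ := by gcongr; linarith [Real.exp_one_gt_d9]

theorem le_log_of_ge {u : ℝ} (hu : 1240 ≤ u) : 7.1 ≤ Real.log u := by
  have h : (71 : ℝ) ≤ Real.log (u ^ 10) := by
    rw [Real.le_log_iff_exp_le (by positivity), show (71 : ℝ) = (71 : ℕ) by norm_num,
      ← Real.exp_one_pow]
    calc Real.exp 1 ^ 71 ≤ 2.7183 ^ 71 := by gcongr; linarith [Real.exp_one_lt_d9]
      _ ≤ 1240 ^ 10 := by norm_num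
      _ ≤ u ^ 10 := by gcongr
  rw [Real.log_pow] at h
  push_cast at h
  linarith

set_option exponentiation.threshold 10000 in
theorem ratio_bound {β : ℝ} {l : ℕ} (hl : 9000 ≤ l) (hβ1 : 1 ≤ β) (hβ : β ^ l ≤ 1543500) :
    β ≤ 1 + 1 / 620 := by
  by_contra! h
  have h1 : (1543500 : ℝ) * 620 ^ 9000 < 621 ^ 9000 := by
    have : 1543500 * 620 ^ 9000 < 621 ^ 9000 := by decide +kernel
    exact_mod_cast this
  have h2 : (621 / 620 : ℝ) ^ 9000 ≤ β ^ l :=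
    calc (621 / 620 : ℝ) ^ 9000 ≤ β ^ 9000 := pow_le_pow_left₀ (by norm_num) (by linarith) _
      _ ≤ β ^ l := pow_le_pow_right₀ hβ1 hl
  rw [div_pow, div_le_iff₀ (pow_pos (by norm_num) _)] at h2
  have h3 : β ^ l * 620 ^ 9000 ≤ 1543500 * 620 ^ 9000 :=
    mul_le_mul_of_nonneg_right hβ (pow_nonneg (by norm_num) _)
  linarith

theorem exists_ratio {y : ℝ} (hy : 1 ≤ y) :
    ∃ R : ℕ, 2 ≤ R ∧ 2 / 5 * R ≤ y ∧ y ≤ 3 / 5 * (R : ℝ) := by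
  have h1 := Nat.le_ceil (5 * y / 3)
  have h2 := Nat.ceil_lt_add_one (show 0 ≤ 5 * y / 3 by positivity)
  refine ⟨⌈5 * y / 3⌉₊, ?_, ?_, by linarith⟩
  · have : 1 < ⌈5 * y / 3⌉₊ := by
      rw [Nat.lt_ceil]; push_cast; linarith
    omega
  · rcases le_or_gt y 1.2 with h | h
    · have : ⌈5 * y / 3⌉₊ ≤ 2 := by rw [Nat.ceil_le]; push_cast; linarith
      have : (⌈5 * y / 3⌉₊ : ℝ) ≤ 2 := by exact_mod_cast this
      linarith
    · linarith

set_option maxHeartbeats 2000000 in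
theorem no_solution_of_large_exponent {D A B m : ℕ} (hD : 0 < D) (hD' : D ≤ 105) (hm : 4500 ≤ m)
    (hA : Odd A) (hA1 : 1 < A) (hB : Odd B) :
    4 * D ^ 3 * B ^ (2 * m + 1) ≠ 3 * A ^ (2 * (2 * m + 1)) + 105 * D ^ 2 := by
  intro h
  rw [pow_mul] at h
  have hB0 : 0 < B := hB.pos
  have hlt : B < A ^ 2 := by
    by_contra! hle
    have h1 : 3 * (A ^ 2) ^ (2 * m + 1) ≤ 3 * B ^ (2 * m + 1) :=
      Nat.mul_le_mul_left _ (Nat.pow_le_pow_left hle _)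
    have h2 : 4 ^ 5 ≤ B ^ (2 * m + 1) :=
      calc 4 ^ 5 ≤ B ^ 5 := Nat.pow_le_pow_left (by nlinarith) _
        _ ≤ _ := Nat.pow_le_pow_right hB0 (by omega)
    have h3 : D ^ 2 ≤ D ^ 3 := Nat.pow_le_pow_right hD (by norm_num)
    have h4 : 0 < D ^ 2 := by positivity
    nlinarith
  have hY2 : B + 2 ≤ A ^ 2 := by
    have : Odd (A ^ 2) := hA.pow
    obtain ⟨s, hs⟩ := this
    obtain ⟨t, ht⟩ := hB
    omega
  obtain ⟨Y, hY⟩ : ∃ Y, Y = A ^ 2 := ⟨_, rfl⟩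
  rw [← hY] at h hlt hY2
  have hBr : (1 : ℝ) ≤ B := by exact_mod_cast hB0
  have hYB : (B : ℝ) + 2 ≤ Y := by exact_mod_cast hY2
  have hDr : (1 : ℝ) ≤ D := by exact_mod_cast hD
  have hDr' : (D : ℝ) ≤ 105 := by exact_mod_cast hD'
  have hr : 4 * (D : ℝ) ^ 3 * B ^ (2 * m + 1) = 3 * Y ^ (2 * m + 1) + 105 * D ^ 2 := by
    exact_mod_cast h
  set u : ℝ := 2 * B / (Y - B) with hu
  have hYB0 : (0 : ℝ) < Y - B := by linarith
  have hβ : (Y / B : ℝ) = 1 + 2 / u := by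
    rw [hu]; field_simp; ring
  have huB : u ≤ B := by
    rw [hu, div_le_iff₀ hYB0]; nlinarith
  set κ : ℝ := 35 * D ^ 2 / B ^ (2 * m + 1) with hκ
  have hκ0 : 0 ≤ κ := by positivity
  have hα : ((4 * D ^ 3 : ℕ) / (3 : ℕ) : ℝ) = (Y / B : ℝ) ^ (2 * m + 1) + κ := by
    rw [hκ, div_pow]
    push_cast
    field_simp
    linarith
  have hα' : ((4 * D ^ 3 : ℕ) / (3 : ℕ) : ℝ) ≤ 1543500 := by
    push_cast
    have : (D : ℝ) ^ 3 ≤ 105 ^ 3 := by gcongr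
    linarith
  have hu1 : 1240 ≤ u := by
    have hb1 : (1 : ℝ) ≤ Y / B := by rw [one_le_div (by positivity)]; linarith
    have := ratio_bound (show 9000 ≤ 2 * m + 1 by omega) hb1 (by linarith)
    have hu0 : 0 < u := by positivity
    rw [hβ] at this
    have h3 : 2 / u ≤ 1 / 620 := by linarith
    rw [div_le_div_iff₀ hu0 (by norm_num)] at h3
    linarith
  have hU := le_log_of_ge hu1
  set U := Real.log u with hUdef
  have hL : U ≤ Real.log B := Real.log_le_log (by linarith) huB
  obtain ⟨y, hy⟩ : ∃ y, y = Real.log B / U := ⟨_, rfl⟩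
  have hyL : Real.log B = y * U := by rw [hy, div_mul_cancel₀]; linarith
  have hy1 : 1 ≤ y := by rw [hy, one_le_div (by linarith)]; exact hL
  obtain ⟨R, hR2, hR3, hR4⟩ := exists_ratio hy1
  have hR2' : (2 : ℝ) ≤ R := by exact_mod_cast hR2
  have hm' : (4500 : ℝ) ≤ m := by exact_mod_cast hm
  have hpos : 0 ≤ (2 * m + 1) * (R - y) / 2 := by
    have : 0 ≤ R - y := by linarith
    positivity
  obtain ⟨c, hc1, hc2⟩ : ∃ c : ℕ, (2 * m + 1) * (R - y) / 2 ≤ (c : ℝ) ∧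
      (c : ℝ) ≤ (2 * m + 1) * (R - y) / 2 + 1 :=
    ⟨_, Nat.le_ceil _, (Nat.ceil_lt_add_one hpos).le⟩
  have hck : c ≤ R * m := by
    have : (c : ℝ) ≤ R * m := by nlinarith
    exact_mod_cast this
  have hRc : R + 1 ≤ 2 * c := by
    have : (R : ℝ) + 1 ≤ 2 * c := by nlinarith
    exact_mod_cast this
  have hpow : u ^ (2 * (R * m) + R - c) ≤ (B : ℝ) ^ (2 * m + 1) * u ^ c := by
    have hu0 : 0 < u := by linarith
    rw [← Real.log_le_log_iff (by positivity) (by positivity), Real.log_mul (by positivity)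
      (by positivity), Real.log_pow, Real.log_pow, Real.log_pow, hyL, Nat.cast_sub (by omega)]
    push_cast
    nlinarith
  have key := log_inequality_of_pow_near (P := 4 * D ^ 3) (Q := 3) (K := 35 * D ^ 2)
    (by norm_num) hB0 hlt (by omega) (by omega) (by linarith) hβ hκ0
    (by rw [hκ, div_mul_cancel₀]; positivity) (by nlinarith) hα hck hRc hpow
  have hgap := quadratic_gap (k := (R * m : ℕ)) (by push_cast; rfl) hR2' hm' hR3 hR4
    (Nat.cast_nonneg c) hc2
  set k : ℝ := ((R * m : ℕ) : ℝ) with hk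
  have hkR : 4500 * (R : ℝ) ≤ k := by rw [hk]; push_cast; nlinarith
  have hα0 : (0 : ℝ) < (4 * D ^ 3 : ℕ) / (3 : ℕ) := by positivity
  have hlogα := log_le_fifteen hα0 hα'
  have hH : Real.log (2 * (35 * D ^ 2 * R * ((4 * D ^ 3 : ℕ) / (3 : ℕ) : ℝ) ^ R))
      ≤ 15 + R + R * 15 := by
    rw [show 2 * (35 * (D : ℝ) ^ 2 * R * ((4 * D ^ 3 : ℕ) / (3 : ℕ) : ℝ) ^ R)
      = (70 * D ^ 2) * R * ((4 * D ^ 3 : ℕ) / (3 : ℕ) : ℝ) ^ R by ring,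
      Real.log_mul (by positivity) (by positivity), Real.log_mul (by positivity) (by positivity),
      Real.log_pow]
    have h1 : Real.log (70 * D ^ 2) ≤ 15 := log_le_fifteen (by positivity) (by nlinarith)
    have h2 : Real.log R ≤ R := (Real.log_le_sub_one_of_pos (by linarith)).trans (by linarith)
    have h3 : R * Real.log ((4 * D ^ 3 : ℕ) / (3 : ℕ) : ℝ) ≤ R * 15 := by gcongr
    linarith
  have hlogk : Real.log k ≤ k / 5000 + 14 := by
    have h1 : Real.log (k / 5000) ≤ k / 5000 - 1 := Real.log_le_sub_one_of_pos (by positivity)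
    rw [Real.log_div (by positivity) (by norm_num)] at h1
    have h2 : Real.log 5000 ≤ 15 := log_le_fifteen (by norm_num) (by norm_num)
    linarith
  have hl3 := log_three_le
  have hl30 : 0 ≤ Real.log 3 := Real.log_nonneg (by norm_num)
  have hk0 : 0 < k := by linarith
  rw [hyL] at key
  have g1 := mul_le_mul_of_nonneg_left hlogk hk0.le
  have g2 := mul_le_mul_of_nonneg_left hH hk0.le
  have g3 : (3 / 2 * k ^ 2 + k * R) * Real.log 3 + k * R * Real.log (3 : ℕ)
      ≤ (3 / 2 * k ^ 2 + 2 * (k * R)) * 1.1 := by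
    have : (3 / 2 * k ^ 2 + k * R) * Real.log 3 + k * R * Real.log (3 : ℕ)
      = (3 / 2 * k ^ 2 + 2 * (k * R)) * Real.log 3 := by push_cast; ring
    rw [this]
    gcongr
  have g4 : 0.2375 * k ^ 2 * U ≤ (k ^ 2 - c ^ 2 - k * (m + 1) * y) * U := by gcongr
  have g5 : 0.2375 * k ^ 2 * 7.1 ≤ 0.2375 * k ^ 2 * U := by gcongr
  have g6 : k * R ≤ k * (k / 4500) := by gcongr; linarith
  have g7 : k * 9000 ≤ k * k := by gcongr; linarith
  linarith

end LargeExponent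

/-! ### Moderate exponents: local obstructions -/

/-- With `q = 2 * k * l + 1`, the element `a ^ (2 * l)` generates the `k`-th roots of unity
modulo `q`, and `q` passes the Pocklington primality criterion with witness `a`. -/
def rootsCheck (l k a : ℕ) : Bool :=
  Nat.beq (a ^ (2 * l * k) % (2 * k * l + 1)) 1 &&
  Nat.beq (Nat.gcd (a ^ (2 * k) - 1) (2 * k * l + 1)) 1 &&
  (List.range k).all fun i =>
    Nat.beq i 0 || !Nat.beq ((a ^ (2 * l) % (2 * k * l + 1)) ^ i % (2 * k * l + 1)) 1

/-- `3 * t + 105 * D ^ 2` is neither zero nor `4 * D ^ 3` times a `2 * k`-th root of unity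
modulo `q`. -/
def valueCheck (D k q t : ℕ) : Bool :=
  !Nat.beq ((3 * t + 105 * D ^ 2) % q) 0 &&
  !Nat.beq ((3 * t + 105 * D ^ 2) ^ (2 * k) % q) ((4 * D ^ 3) ^ (2 * k) % q)

/-- Certifies that `4 * D ^ 3 * B ^ l = 3 * A ^ (2 * l) + 105 * D ^ 2` has no solution modulo
`2 * k * l + 1`. -/
def localCheck (l D k a : ℕ) : Bool :=
  valueCheck D k (2 * k * l + 1) 0 && rootsCheck l k a &&
  (List.range k).all fun i =>
    valueCheck D k (2 * k * l + 1) ((a ^ (2 * l) % (2 * k * l + 1)) ^ i % (2 * k * l + 1))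

/-- Searches for a modulus certifying the insolubility for a given exponent. -/
def exponentCheck (l D : ℕ) : Bool :=
  (List.range (min 39 (2 * l + 2))).any fun k =>
    !Nat.beq k 0 && Nat.beq (2 ^ (2 * k * l) % (2 * k * l + 1)) 1 &&
    [2, 3, 5, 6, 7, 10, 11, 13, 17, 19].any (localCheck l D k)

/-- Runs `exponentCheck` on every `l` in `[s, s + n)` without small proper divisors. -/
def rangeCheck (s n : ℕ) : Bool :=
  (List.range n).all fun i =>
    [2, 3, 5, 7, 11, 13, 17, 19, 23, 29, 31, 37, 41, 43, 47, 53, 59, 61, 67, 71, 73, 79, 83,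
      89].any (fun p => Nat.blt p (s + i) && Nat.beq ((s + i) % p) 0) ||
    [1, 3, 5, 7, 15, 21, 35, 105].all (exponentCheck (s + i))

theorem beq_eq_false_iff_ne_nat {a b : ℕ} : Nat.beq a b = false ↔ a ≠ b := by
  rw [← Bool.not_eq_true, Nat.beq_eq]

theorem prime_of_pocklington {l k a : ℕ} (hl : l.Prime) (hl2 : l ≠ 2) (hk : 0 < k)
    (hkl : k < 2 * l + 2) (h1 : a ^ (2 * l * k) % (2 * k * l + 1) = 1)
    (h2 : Nat.gcd (a ^ (2 * k) - 1) (2 * k * l + 1) = 1) : (2 * k * l + 1).Prime := by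
  set q := 2 * k * l + 1 with hq
  have hkl0 : 0 < k * l := Nat.mul_pos hk hl.pos
  have hq1 : q ≠ 1 := by rw [hq, mul_assoc]; omega
  set p := q.minFac with hp
  have hpp : p.Prime := Nat.minFac_prime hq1
  have : Fact p.Prime := ⟨hpp⟩
  have : Fact l.Prime := ⟨hl⟩
  have hpq : p ∣ q := Nat.minFac_dvd q
  have ha : 0 < a := by
    rcases Nat.eq_zero_or_pos a with rfl | h
    · rw [zero_pow (by have := hl.pos; positivity)] at h1
      simp at h1
    · exact h
  have hb1 : ((a : ZMod p) ^ (2 * k)) ^ l = 1 := by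
    have h3 : q ∣ a ^ (2 * l * k) - 1 := by
      rw [← h1]; exact Nat.dvd_sub_mod _
    have h4 : ((a ^ (2 * l * k) - 1 : ℕ) : ZMod p) = 0 :=
      (ZMod.natCast_eq_zero_iff _ _).2 (hpq.trans h3)
    rw [Nat.cast_sub (Nat.one_le_pow _ _ ha), sub_eq_zero] at h4
    rw [← pow_mul, show 2 * k * l = 2 * l * k by ring]
    exact_mod_cast h4
  have hb2 : (a : ZMod p) ^ (2 * k) ≠ 1 := by
    intro h3
    have h4 : ((a ^ (2 * k) - 1 : ℕ) : ZMod p) = 0 := by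
      rw [Nat.cast_sub (Nat.one_le_pow _ _ ha)]
      push_cast
      rw [h3]
      ring
    have h5 := Nat.dvd_gcd ((ZMod.natCast_eq_zero_iff _ _).1 h4) hpq
    rw [h2] at h5
    exact hpp.one_lt.ne' (Nat.dvd_one.1 h5)
  have hord : orderOf ((a : ZMod p) ^ (2 * k)) = l := orderOf_eq_prime hb1 hb2
  have hb0 : (a : ZMod p) ^ (2 * k) ≠ 0 := by
    intro h3
    rw [h3, zero_pow hl.ne_zero] at hb1
    exact zero_ne_one hb1
  have hdvd : l ∣ p - 1 := by
    rw [← hord]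
    exact orderOf_dvd_of_pow_eq_one (ZMod.pow_card_sub_one_eq_one hb0)
  have hlodd : l % 2 = 1 := hl.eq_two_or_odd.resolve_left hl2
  have hpodd : p % 2 = 1 := by
    refine hpp.eq_two_or_odd.resolve_left fun h3 => ?_
    rw [h3, hq, mul_assoc] at hpq
    omega
  have hdvd2 : 2 * l ∣ p - 1 := by
    refine Nat.Coprime.mul_dvd_of_dvd_of_dvd ?_ (by omega) hdvd
    exact (Nat.coprime_primes Nat.prime_two hl).2 (Ne.symm hl2)
  have hple : 2 * l + 1 ≤ p := by
    have := Nat.le_of_dvd (by have := hpp.two_le; omega) hdvd2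
    omega
  by_contra hnp
  have hsq := Nat.minFac_sq_le_self (by omega) hnp
  rw [← hp] at hsq
  have h3 : k * l ≤ (2 * l + 1) * l := Nat.mul_le_mul_right _ (by omega)
  have := hl.pos
  nlinarith

theorem valueCheck_sound {D k q t : ℕ} (h : valueCheck D k q t = true) :
    (3 * t + 105 * D ^ 2 : ZMod q) ≠ 0 ∧
      (3 * t + 105 * D ^ 2 : ZMod q) ^ (2 * k) ≠ (4 * D ^ 3) ^ (2 * k) := by
  simp only [valueCheck, Bool.and_eq_true, Bool.not_eq_true', beq_eq_false_iff_ne_nat] at h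
  constructor
  · intro h0
    apply h.1
    have h1 : ((3 * t + 105 * D ^ 2 : ℕ) : ZMod q) = 0 := by push_cast; exact h0
    exact Nat.mod_eq_zero_of_dvd ((ZMod.natCast_eq_zero_iff _ _).1 h1)
  · intro h0
    apply h.2
    rw [← ZMod.natCast_eq_natCast_iff']
    push_cast
    exact h0

theorem localCheck_sound {l D k a : ℕ} (hl : l.Prime) (hl2 : l ≠ 2) (hk : 0 < k)
    (hkl : k < 2 * l + 2) (h : localCheck l D k a = true) (A B : ℕ) :
    4 * D ^ 3 * B ^ l ≠ 3 * A ^ (2 * l) + 105 * D ^ 2 := by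
  simp only [localCheck, rootsCheck, Bool.and_eq_true, List.all_eq_true, List.mem_range,
    Bool.or_eq_true, Bool.not_eq_true', Nat.beq_eq, beq_eq_false_iff_ne_nat] at h
  obtain ⟨⟨h0, ⟨h1, h2⟩, h3⟩, h4⟩ := h
  have hprime := prime_of_pocklington hl hl2 hk hkl h1 h2
  set q := 2 * k * l + 1 with hq
  have : Fact q.Prime := ⟨hprime⟩
  have hcast : ∀ i, (((a ^ (2 * l) % q) ^ i % q : ℕ) : ZMod q) = ((a : ZMod q) ^ (2 * l)) ^ i := by
    intro i
    rw [ZMod.natCast_mod, Nat.cast_pow, ZMod.natCast_mod, Nat.cast_pow]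
  have hroot : IsPrimitiveRoot ((a : ZMod q) ^ (2 * l)) k := by
    refine IsPrimitiveRoot.mk_of_lt _ hk ?_ ?_
    · rw [← pow_mul]
      have h5 : ((a ^ (2 * l * k) % q : ℕ) : ZMod q) = (1 : ℕ) := by rw [h1]
      rw [ZMod.natCast_mod] at h5
      exact_mod_cast h5
    · intro i hi0 hik h5
      rcases h3 i hik with h6 | h6
      · omega
      · apply h6
        rw [← hcast, ← Nat.cast_one, ZMod.natCast_eq_natCast_iff', Nat.mod_mod,
          Nat.mod_eq_of_lt hprime.one_lt] at h5
        exact h5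
  intro heq
  have heq' : (4 * D ^ 3 : ZMod q) * B ^ l = 3 * (A : ZMod q) ^ (2 * l) + 105 * D ^ 2 := by
    exact_mod_cast congrArg (Nat.cast : ℕ → ZMod q) heq
  have hval : ∀ t : ℕ, valueCheck D k q t = true → (A : ZMod q) ^ (2 * l) ≠ t := by
    intro t ht hAt
    obtain ⟨v1, v2⟩ := valueCheck_sound ht
    rw [← hAt, ← heq'] at v1 v2
    apply v2
    have hB : (B : ZMod q) ≠ 0 := by
      intro hB
      apply v1
      rw [hB, zero_pow hl.ne_zero, mul_zero]
    rw [mul_pow, ← pow_mul, show l * (2 * k) = q - 1 by rw [hq, Nat.add_sub_cancel]; ring,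
      ZMod.pow_card_sub_one_eq_one hB, mul_one]
  by_cases hA : (A : ZMod q) = 0
  · refine hval 0 h0 ?_
    rw [hA, zero_pow (by have := hl.pos; omega), Nat.cast_zero]
  · have h5 : ((A : ZMod q) ^ (2 * l)) ^ k = 1 := by
      rw [← pow_mul, show 2 * l * k = q - 1 by rw [hq, Nat.add_sub_cancel]; ring]
      exact ZMod.pow_card_sub_one_eq_one hA
    have : NeZero k := ⟨hk.ne'⟩
    obtain ⟨i, hi, h6⟩ := hroot.eq_pow_of_pow_eq_one h5
    refine hval _ (h4 i hi) ?_
    rw [hcast, h6]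

theorem exponentCheck_sound {l D : ℕ} (hl : l.Prime) (hl2 : l ≠ 2)
    (h : exponentCheck l D = true) (A B : ℕ) :
    4 * D ^ 3 * B ^ l ≠ 3 * A ^ (2 * l) + 105 * D ^ 2 := by
  rw [exponentCheck, List.any_eq_true] at h
  obtain ⟨k, hk, h⟩ := h
  simp only [Bool.and_eq_true, Bool.not_eq_true', beq_eq_false_iff_ne_nat] at h
  obtain ⟨a, -, h1⟩ := List.any_eq_true.1 h.2
  rw [List.mem_range] at hk
  exact localCheck_sound hl hl2 (Nat.pos_of_ne_zero h.1.1) (by omega) h1 A B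

theorem rangeCheck_sound {s n l D : ℕ} (h : rangeCheck s n = true) (hl : l.Prime) (hl2 : l ≠ 2)
    (hs : s ≤ l) (hn : l < s + n) (hD : D ∈ [1, 3, 5, 7, 15, 21, 35, 105]) (A B : ℕ) :
    4 * D ^ 3 * B ^ l ≠ 3 * A ^ (2 * l) + 105 * D ^ 2 := by
  rw [rangeCheck, List.all_eq_true] at h
  obtain ⟨i, rfl⟩ := Nat.exists_eq_add_of_le hs
  have h1 := h i (List.mem_range.2 (by omega))
  rw [Bool.or_eq_true, List.any_eq_true] at h1
  rcases h1 with ⟨p, hp, h2⟩ | h1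
  · rw [Bool.and_eq_true, Nat.beq_eq, Nat.blt_eq] at h2
    have hp1 : p ≠ 1 := by
      rintro rfl
      simp at hp
    rcases (Nat.dvd_prime hl).1 (Nat.dvd_of_mod_eq_zero h2.2) with h3 | h3
    · exact absurd h3 hp1
    · omega
  · exact exponentCheck_sound hl hl2 (List.all_eq_true.1 h1 D hD) A B

theorem rangeCheck_11 : rangeCheck 11 1800 = true := by decide +kernel

theorem rangeCheck_1811 : rangeCheck 1811 1800 = true := by decide +kernel

theorem rangeCheck_3611 : rangeCheck 3611 1800 = true := by decide +kernel

theorem rangeCheck_5411 : rangeCheck 5411 1800 = true := by decide +kernel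

theorem rangeCheck_7211 : rangeCheck 7211 1800 = true := by decide +kernel

theorem no_solution_of_moderate_exponent {l D : ℕ} (hl : l.Prime) (hl11 : 11 ≤ l) (hl' : l < 9011)
    (hD : D ∈ [1, 3, 5, 7, 15, 21, 35, 105]) (A B : ℕ) :
    4 * D ^ 3 * B ^ l ≠ 3 * A ^ (2 * l) + 105 * D ^ 2 := by
  have hl2 : l ≠ 2 := by omega
  rcases lt_or_ge l 1811 with h1 | h1
  · exact rangeCheck_sound rangeCheck_11 hl hl2 hl11 h1 hD A B
  rcases lt_or_ge l 3611 with h2 | h2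
  · exact rangeCheck_sound rangeCheck_1811 hl hl2 h1 h2 hD A B
  rcases lt_or_ge l 5411 with h3 | h3
  · exact rangeCheck_sound rangeCheck_3611 hl hl2 h2 h3 hD A B
  rcases lt_or_ge l 7211 with h4 | h4
  · exact rangeCheck_sound rangeCheck_5411 hl hl2 h3 h4 hD A B
  · exact rangeCheck_sound rangeCheck_7211 hl hl2 h4 hl' hD A B

theorem no_solution_of_exponent_five_or_seven {l D : ℕ} (hl : l = 5 ∨ l = 7)
    (hD : D ∈ [1, 5, 15, 21, 35, 105]) (A B : ℕ) :
    4 * D ^ 3 * B ^ l ≠ 3 * A ^ (2 * l) + 105 * D ^ 2 := by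
  have hcheck : ∀ l ∈ [5, 7], ∀ D ∈ [1, 5, 15, 21, 35, 105], exponentCheck l D = true := by
    decide +kernel
  have hprime : l.Prime := by rcases hl with rfl | rfl <;> norm_num
  exact exponentCheck_sound hprime (by omega) (hcheck l (by simpa using hl) D hD) A B

/-! ### Exponents five and seven: quadratic rings -/

/-- The binary quadratic form `a X² + b X Y + c Y²` of discriminant `-35` is obtained by an
integral substitution from one of the two reduced forms, and by a substitution of determinant
`±1` if this is the principal form. -/
def IsRepresentedDiscNegThirtyFive (a b c : ℤ) : Prop :=
  (∃ p q r s : ℤ, (p * s - q * r = 1 ∨ p * s - q * r = -1) ∧ a = p ^ 2 + p * r + 9 * r ^ 2 ∧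
    b = 2 * p * q + p * s + q * r + 18 * r * s ∧ c = q ^ 2 + q * s + 9 * s ^ 2) ∨
  ∃ p q r s : ℤ, a = 3 * p ^ 2 + p * r + 3 * r ^ 2 ∧
    b = 6 * p * q + p * s + q * r + 6 * r * s ∧ c = 3 * q ^ 2 + q * s + 3 * s ^ 2

theorem form_reduction_disc_neg_thirtyfive (n : ℕ) : ∀ a b c : ℤ, 0 < a → 0 < c →
    b ^ 2 + 35 = 4 * (a * c) → |b| ≤ n →
    IsRepresentedDiscNegThirtyFive a b c := by
  induction n with
  | zero =>
    intro a b c _ _ h hb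
    rw [Nat.cast_zero, abs_nonpos_iff] at hb
    subst hb
    omega
  | succ n ih =>
    intro a b c ha hc h hb
    push_cast at hb
    rw [abs_le] at hb
    have shift : ∀ e : ℤ, |b - 2 * e * a| ≤ n → 0 < e ^ 2 * a - e * b + c := by
      intro e _
      have : 4 * (a * (e ^ 2 * a - e * b + c)) = (b - 2 * e * a) ^ 2 + 35 := by
        linear_combination -h
      have h1 : 0 < a * (e ^ 2 * a - e * b + c) := by nlinarith [sq_nonneg (b - 2 * e * a)]
      exact (pos_iff_pos_of_mul_pos h1).1 ha
    have shift' : ∀ e : ℤ, |b - 2 * e * c| ≤ n → 0 < e ^ 2 * c - e * b + a := by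
      intro e _
      have : 4 * (c * (e ^ 2 * c - e * b + a)) = (b - 2 * e * c) ^ 2 + 35 := by
        linear_combination -h
      have h1 : 0 < c * (e ^ 2 * c - e * b + a) := by nlinarith [sq_nonneg (b - 2 * e * c)]
      exact (pos_iff_pos_of_mul_pos h1).1 hc
    have stepA : ∀ e : ℤ, |b - 2 * e * a| ≤ n → _ := fun e he =>
      ih a (b - 2 * e * a) (e ^ 2 * a - e * b + c) ha (shift e he) (by linear_combination h) he
    have stepC : ∀ e : ℤ, |b - 2 * e * c| ≤ n → _ := fun e he =>
      ih (e ^ 2 * c - e * b + a) (b - 2 * e * c) c (shift' e he) hc (by linear_combination h) he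
    have finA : ∀ e : ℤ, |b - 2 * e * a| ≤ n →
        IsRepresentedDiscNegThirtyFive a b c := fun e he => by
      rcases stepA e he with ⟨p, q, r, s, h1, h2, h3, h4⟩ | ⟨p, q, r, s, h2, h3, h4⟩
      · refine Or.inl ⟨p, q + e * p, r, s + e * r, ?_, h2, ?_, ?_⟩
        · rcases h1 with h1 | h1
          · left; linear_combination h1
          · right; linear_combination h1
        · linear_combination h3 + 2 * e * h2
        · linear_combination h4 + e * h3 + e ^ 2 * h2
      · refine Or.inr ⟨p, q + e * p, r, s + e * r, h2, ?_, ?_⟩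
        · linear_combination h3 + 2 * e * h2
        · linear_combination h4 + e * h3 + e ^ 2 * h2
    have finC : ∀ e : ℤ, |b - 2 * e * c| ≤ n →
        IsRepresentedDiscNegThirtyFive a b c := fun e he => by
      rcases stepC e he with ⟨p, q, r, s, h1, h2, h3, h4⟩ | ⟨p, q, r, s, h2, h3, h4⟩
      · refine Or.inl ⟨p + e * q, q, r + e * s, s, ?_, ?_, ?_, h4⟩
        · rcases h1 with h1 | h1
          · left; linear_combination h1
          · right; linear_combination h1
        · linear_combination h2 + e * h3 + e ^ 2 * h4
        · linear_combination h3 + 2 * e * h4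
      · refine Or.inr ⟨p + e * q, q, r + e * s, s, ?_, ?_, h4⟩
        · linear_combination h2 + e * h3 + e ^ 2 * h4
        · linear_combination h3 + 2 * e * h4
    by_cases h1 : a < b
    · exact finA 1 (by rw [abs_le]; omega)
    by_cases h2 : b < -a
    · exact finA (-1) (by rw [abs_le]; omega)
    by_cases h3 : c < b
    · exact finC 1 (by rw [abs_le]; omega)
    by_cases h4 : b < -c
    · exact finC (-1) (by rw [abs_le]; omega)
    push Not at h1 h2 h3 h4
    have hba : b ^ 2 ≤ a * c := by
      have e1 : |b| ≤ a := abs_le.2 ⟨h2, h1⟩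
      have e2 : |b| ≤ c := abs_le.2 ⟨h4, h3⟩
      calc b ^ 2 = |b| * |b| := by rw [← sq, sq_abs]
        _ ≤ a * c := mul_le_mul e1 e2 (abs_nonneg _) ha.le
    have hac : a * c ≤ 11 := by omega
    have ha' : a ≤ 11 := by nlinarith
    have hc' : c ≤ 11 := by nlinarith
    have hb1 : b ≤ 3 := by nlinarith
    have hb2 : -3 ≤ b := by nlinarith
    have hcases : (b = 1 ∨ b = -1) ∧ ((a = 1 ∧ c = 9) ∨ (a = 9 ∧ c = 1) ∨ (a = 3 ∧ c = 3)) := by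
      interval_cases b <;> interval_cases a <;> omega
    obtain ⟨rfl | rfl, ⟨rfl, rfl⟩ | ⟨rfl, rfl⟩ | ⟨rfl, rfl⟩⟩ := hcases
    · exact Or.inl ⟨1, 0, 0, 1, by norm_num⟩
    · exact Or.inl ⟨0, 1, 1, 0, by norm_num⟩
    · exact Or.inr ⟨1, 0, 0, 1, by norm_num⟩
    · exact Or.inl ⟨1, 0, 0, -1, by norm_num⟩
    · exact Or.inl ⟨0, 1, -1, 0, by norm_num⟩
    · exact Or.inr ⟨1, 0, 0, -1, by norm_num⟩

/-- The ring of integers of `ℚ(√-35)`. -/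
abbrev IntSqrtNegThirtyFive := QuadraticAlgebra ℤ (-9) 1

open QuadraticAlgebra in
theorem exists_eq_pow_of_norm_eq_pow {z B : ℤ} {l : ℕ} (hl : Odd l) (hl1 : 1 < l) (hB : 0 < B)
    (hz : Odd z) (h5 : ¬ (5 : ℤ) ∣ z) (h7 : ¬ (7 : ℤ) ∣ z) (h : z ^ 2 + 35 = 4 * B ^ l) :
    ∃ γ : IntSqrtNegThirtyFive, (γ ^ l).im = 1 ∨ (γ ^ l).im = -1 := by
  obtain ⟨j, rfl⟩ : ∃ j, l = j + 1 := ⟨l - 1, by omega⟩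
  obtain ⟨w, hw⟩ := hz
  have hform := form_reduction_disc_neg_thirtyfive z.natAbs B z (B ^ j) hB (by positivity)
    (by rw [h, pow_succ]; ring) (by simp)
  rcases hform with ⟨p, q, r, s, h1, h2, h3, h4⟩ | ⟨p, q, r, s, h2, -, -⟩
  · have hcop : IsCoprime z B := by
      rw [Int.isCoprime_iff_gcd_eq_one]
      by_contra hg
      obtain ⟨P, hP, hPg⟩ := Nat.exists_prime_and_dvd hg
      have hPz : (P : ℤ) ∣ z := (Int.natCast_dvd_natCast.2 hPg).trans (Int.gcd_dvd_left _ _)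
      have hPB : (P : ℤ) ∣ B := (Int.natCast_dvd_natCast.2 hPg).trans (Int.gcd_dvd_right _ _)
      have h35 : (P : ℤ) ∣ 35 := by
        have e : (35 : ℤ) = 4 * B ^ (j + 1) - z ^ 2 := by linarith
        rw [e]
        exact dvd_sub ((dvd_pow hPB (by omega)).mul_left _) (dvd_pow hPz (by norm_num))
      have h35' : P ∣ 5 * 7 := by exact_mod_cast h35
      rcases (Nat.Prime.dvd_mul hP).1 h35' with h | h
      · rw [(Nat.prime_dvd_prime_iff_eq hP (by norm_num)).1 h] at hPz
        exact h5 hPz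
      · rw [(Nat.prime_dvd_prime_iff_eq hP (by norm_num)).1 h] at hPz
        exact h7 hPz
    set γ : IntSqrtNegThirtyFive := ⟨p, r⟩ with hγ
    set β : IntSqrtNegThirtyFive := ⟨q, s⟩ with hβ
    set δ : IntSqrtNegThirtyFive := γ * star β with hδ
    have hnγ : γ * star γ = (B : IntSqrtNegThirtyFive) := by
      ext
      · rw [re_intCast, h2]; simp [hγ]; ring
      · rw [im_intCast]; simp [hγ]; ring
    have hnβ : β * star β = ((B ^ j : ℤ) : IntSqrtNegThirtyFive) := by
      ext
      · rw [re_intCast, h4]; simp [hβ]; ring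
      · rw [im_intCast]; simp [hβ]; ring
    have hnδ : δ * star δ = ((B ^ (j + 1) : ℤ) : IntSqrtNegThirtyFive) := by
      calc δ * star δ = (γ * star γ) * (β * star β) := by
            rw [hδ, star_mul', star_star]; ring
        _ = _ := by rw [hnγ, hnβ, pow_succ]; push_cast; ring
    have htr : δ + star δ = (z : IntSqrtNegThirtyFive) := by
      ext
      · rw [re_intCast, h3]; simp [hδ, hγ, hβ]; ring
      · simp
    have him : δ.im = 1 ∨ δ.im = -1 := by
      have : δ.im = -(p * s - q * r) := by simp [hδ, hγ, hβ]; ring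
      rw [this]
      omega
    have hcopγ : IsCoprime γ (star δ) := by
      obtain ⟨x, y, hxy⟩ := hcop
      refine ⟨x * star β + y * star γ, x, ?_⟩
      have e : (x * star β + y * star γ) * γ + x * star δ
          = x * (δ + star δ) + y * (γ * star γ) := by rw [hδ]; ring
      rw [e, htr, hnγ]
      exact_mod_cast congrArg (Int.cast : ℤ → IntSqrtNegThirtyFive) hxy
    have hdvd : γ ^ (j + 1) ∣ δ := by
      refine (hcopγ.pow_left (m := j + 1)).dvd_of_dvd_mul_right ?_
      rw [hnδ, Int.cast_pow, ← hnγ, mul_pow]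
      exact dvd_mul_right _ _
    obtain ⟨η, hη⟩ := hdvd
    have hnη : η.re ^ 2 + η.re * η.im + 9 * η.im ^ 2 = 1 := by
      have e2 : norm γ = B := by rw [norm_def, h2]; ring
      have e3 : norm β = B ^ j := by rw [norm_def, h4]; ring
      have e1 : norm δ = B ^ (j + 1) := by
        rw [hδ, map_mul, QuadraticAlgebra.norm_star, e2, e3, pow_succ, mul_comm]
      rw [hη, map_mul, map_pow, e2] at e1
      have hne : B ^ (j + 1) ≠ 0 := by positivity
      have e4 := mul_left_cancel₀ hne (e1.trans (mul_one _).symm)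
      rw [norm_def] at e4
      linear_combination e4
    have hη0 : η.im = 0 := by
      have : 35 * η.im ^ 2 ≤ 4 := by nlinarith [sq_nonneg (2 * η.re + η.im)]
      by_contra hne
      have : 1 ≤ η.im ^ 2 := Int.one_le_abs hne |>.trans (by
        rw [← sq_abs]; nlinarith [Int.one_le_abs hne])
      omega
    have hη1 : η.re = 1 ∨ η.re = -1 := by
      rw [hη0] at hnη
      have : η.re ^ 2 = 1 := by linarith
      exact pow_eq_one_iff_cases.1 this |>.resolve_left (by norm_num) |>.imp_right And.left
    refine ⟨γ, ?_⟩
    rw [hη, im_mul, hη0] at him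
    rcases hη1 with e | e <;> rw [e] at him <;> omega
  · exfalso
    obtain ⟨m, hm⟩ := hl
    have hsq : ∀ z B p r x : ZMod 5, z ≠ 0 → z ^ 2 = 4 * (B * x ^ 2) →
      B = 3 * p ^ 2 + p * r + 3 * r ^ 2 → False := by decide
    refine hsq z B p r ((B : ZMod 5) ^ m) ?_ ?_ ?_
    · rwa [Ne, ZMod.intCast_zmod_eq_zero_iff_dvd z 5]
    · have := congrArg (Int.cast : ℤ → ZMod 5) h
      push_cast at this
      rw [hm] at this
      linear_combination this - (by decide : (35 : ZMod 5) = 0)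
    · rw [h2]; push_cast; ring

open QuadraticAlgebra in
theorem im_pow_five_ne (γ : IntSqrtNegThirtyFive) : (γ ^ 5).im ≠ 1 ∧ (γ ^ 5).im ≠ -1 := by
  have e : 16 * (γ ^ 5).im = 5 * (γ.im * ((2 * γ.re + γ.im) ^ 4
      - 70 * (2 * γ.re + γ.im) ^ 2 * γ.im ^ 2 + 245 * γ.im ^ 4)) := by
    rw [show γ ^ 5 = γ * γ * γ * γ * γ by ring]
    simp only [im_mul, re_mul]
    ring
  omega

open QuadraticAlgebra in
theorem im_pow_seven_ne (γ : IntSqrtNegThirtyFive) : (γ ^ 7).im ≠ 1 ∧ (γ ^ 7).im ≠ -1 := by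
  have e : 64 * (γ ^ 7).im = 7 * (γ.im * ((2 * γ.re + γ.im) ^ 6
      - 175 * (2 * γ.re + γ.im) ^ 4 * γ.im ^ 2 + 3675 * (2 * γ.re + γ.im) ^ 2 * γ.im ^ 4
      - 6125 * γ.im ^ 6)) := by
    rw [show γ ^ 7 = γ * γ * γ * γ * γ * γ * γ by ring]
    simp only [im_mul, re_mul]
    ring
  omega

theorem sq_add_thirtyfive_ne {z B : ℤ} {l : ℕ} (hl : l = 5 ∨ l = 7) (hB : 0 < B)
    (hz : Odd z) : z ^ 2 + 35 ≠ 4 * B ^ l := by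
  intro h
  have key : ∀ P : ℤ, Prime P → P ∣ 35 → ¬ P ^ 2 ∣ 35 → IsCoprime P 4 → ¬ P ∣ z := by
    intro P hP h1 h2 h4 hPz
    have h3 : P ∣ 4 * B ^ l := h ▸ dvd_add (dvd_pow hPz (by norm_num)) h1
    have h5 : P ∣ B := hP.dvd_of_dvd_pow (h4.dvd_of_dvd_mul_left h3)
    have h6 : P ^ 2 ∣ B ^ l := (pow_dvd_pow_of_dvd h5 2).trans (pow_dvd_pow _ (by omega))
    refine h2 ((dvd_add_right (pow_dvd_pow_of_dvd hPz 2)).1 ?_)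
    rw [h]
    exact h6.mul_left 4
  obtain ⟨γ, hγ⟩ := exists_eq_pow_of_norm_eq_pow (by rcases hl with rfl | rfl <;> decide)
    (by omega) hB hz (key 5 (by norm_num) (by norm_num) (by norm_num) ⟨1, -1, by norm_num⟩)
    (key 7 (by norm_num) (by norm_num) (by norm_num) ⟨-1, 2, by norm_num⟩) h
  have := im_pow_five_ne γ
  have := im_pow_seven_ne γ
  rcases hl with rfl | rfl <;> omega

theorem no_solution_of_gcd_three {l A B : ℕ} (hl : l = 5 ∨ l = 7) (hA : Odd A) :
    4 * 3 ^ 3 * B ^ l ≠ 3 * A ^ (2 * l) + 105 * 3 ^ 2 := by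
  intro h
  have h3 : 3 ∣ A := by
    refine Nat.prime_three.dvd_of_dvd_pow (n := 2 * l) ?_
    omega
  obtain ⟨a, rfl⟩ := h3
  obtain ⟨k, rfl⟩ : ∃ k, l = k + 1 := ⟨l - 1, by omega⟩
  have hB : 0 < B := by
    rcases Nat.eq_zero_or_pos B with rfl | hB
    · simp at h
    · exact hB
  refine sq_add_thirtyfive_ne (z := 3 ^ k * a ^ (k + 1)) (B := B) hl (by exact_mod_cast hB) ?_ ?_
  · have ha : Odd (a : ℤ) := by exact_mod_cast (Nat.odd_mul.1 hA).2
    exact (Odd.pow (by decide)).mul ha.pow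
  · have h' : (4 * 3 ^ 3 * B ^ (k + 1) : ℤ) = 3 * (3 * a) ^ (2 * (k + 1)) + 105 * 3 ^ 2 := by
      exact_mod_cast h
    have e : (3 * (3 * a) ^ (2 * (k + 1)) : ℤ) = 27 * (3 ^ k * a ^ (k + 1)) ^ 2 := by ring
    rw [e] at h'
    linarith

theorem no_solution_of_gcd_seven {l A B : ℕ} (hl : l = 5 ∨ l = 7) :
    4 * 7 ^ 3 * B ^ l ≠ 3 * A ^ (2 * l) + 105 * 7 ^ 2 := by
  intro h
  have h7 : 7 ∣ A := by
    refine Nat.Prime.dvd_of_dvd_pow (n := 2 * l) (by norm_num) ?_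
    omega
  obtain ⟨a, rfl⟩ := h7
  rcases hl with rfl | rfl
  · have h' : 4 * B ^ 5 = 3 * 7 ^ 7 * a ^ 10 + 15 := by
      rw [mul_pow] at h
      norm_num at h ⊢
      linarith
    have key : ∀ a b : ZMod 25, 4 * b ^ 5 ≠ 3 * 7 ^ 7 * a ^ 10 + 15 := by decide
    exact key a B (by exact_mod_cast congrArg (Nat.cast : ℕ → ZMod 25) h')
  · have h' : 4 * B ^ 7 = 3 * 7 ^ 11 * a ^ 14 + 15 := by
      rw [mul_pow] at h
      norm_num at h ⊢
      linarith
    have key : ∀ b : ZMod 49, 4 * b ^ 7 ≠ 15 := by decide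
    refine key B ?_
    have := congrArg (Nat.cast : ℕ → ZMod 49) h'
    push_cast at this
    linear_combination this + 3 * 7 ^ 9 * (a : ZMod 49) ^ 14 * (by decide : (49 : ZMod 49) = 0)

/-! ### The cubic equation `s³ + 35 = 36 b³` -/

section CubicEquation

open Polynomial

/-- The matrix of multiplication by the unit `1 - 6θ + 3θ²` of `ℤ[θ]`, `θ³ = 6`,
in the basis `1, θ, θ²`. -/
def unitMatrix : Matrix (Fin 3) (Fin 3) ℤ := !![1, 18, -36; -6, 1, 18; 3, -6, 1]

theorem unitMatrix_mulVec (x y z : ℤ) : unitMatrix.mulVec ![x, y, z] =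
    ![x + 18 * y - 36 * z, -6 * x + y + 18 * z, 3 * x - 6 * y + z] := by
  ext i
  fin_cases i <;> simp [unitMatrix, Matrix.mulVec, dotProduct, Fin.sum_univ_three] <;> ring

theorem norm_eq_neg_thirtyfive_bounded : ∀ x ∈ Finset.Icc (-47 : ℤ) 47, ∀ k ∈ Finset.Icc (-4 : ℤ) 4,
    ∀ z ∈ Finset.Icc (-14 : ℤ) 14,
    x ^ 3 + 6 * (6 * k) ^ 3 + 36 * z ^ 3 - 18 * x * (6 * k) * z = -35 →
    (x = 1 ∧ k = 0 ∧ z = -1) ∨ (x = 37 ∧ k = -4 ∧ z = 2) ∨ (x = -11 ∧ k = -1 ∧ z = -3) ∨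
      (x = -11 ∧ k = 1 ∧ z = 0) := by
  decide +kernel

theorem abs_lt_of_sum_and_form_le {u v w : ℝ} (h1 : -(7 / 3) ≤ u + v + w) (h2 : u + v + w < 0)
    (h3 : u ^ 2 + v ^ 2 + w ^ 2 - u * v - u * w - v * w ≤ 4908) : |u| < 47.8 := by
  have h4 : (3 * u - (u + v + w)) ^ 2 ≤ 141 ^ 2 := by nlinarith only [h3, sq_nonneg (v - w)]
  have h5 := abs_le.1 (abs_le_of_sq_le_sq h4 (by norm_num))
  exact abs_lt.2 ⟨by linarith [h5.1], by linarith [h5.2]⟩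

theorem exists_unitMatrix_pow_of_range {θ : ℝ} (hθ : θ ^ 3 = 6) (hθ1 : 1.817 < θ) (hθ2 : θ < 1.818)
    {x k z : ℤ} (hN : x ^ 3 + 6 * (6 * k) ^ 3 + 36 * z ^ 3 - 18 * x * (6 * k) * z = -35)
    (h1 : -(7 / 3) ≤ x + 6 * k * θ + z * θ ^ 2)
    (h2 : (x + 6 * k * θ + z * θ ^ 2) * (109 + 60 * θ + 33 * θ ^ 2) ≤ -(7 / 3)) :
    ∃ m : ℕ, ![x, 6 * k, z] = (unitMatrix ^ m).mulVec ![1, 0, -1] ∨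
      ![x, 6 * k, z] = (unitMatrix ^ m).mulVec ![-11, -6, -3] := by
  set u : ℝ := (x : ℝ) with hu
  set v : ℝ := 6 * k * θ with hv
  set w : ℝ := z * θ ^ 2 with hw
  set R : ℝ := u + v + w with hR
  set Q : ℝ := u ^ 2 + v ^ 2 + w ^ 2 - u * v - u * w - v * w with hQ
  have hNR : (x ^ 3 + 6 * (6 * k) ^ 3 + 36 * z ^ 3 - 18 * x * (6 * k) * z : ℝ) = -35 := by
    exact_mod_cast hN
  have hRQ : R * Q = -35 := by
    rw [← hNR, hR, hQ, hv, hw]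
    linear_combination (216 * k ^ 3 + z ^ 3 * (θ ^ 3 + 6) - 18 * u * k * z : ℝ) * hθ
  have hθsq : θ ^ 2 < 3.3052 := by nlinarith
  have hK : 109 + 60 * θ + 33 * θ ^ 2 < 327.2 := by linarith
  have hK0 : 0 < 109 + 60 * θ + 33 * θ ^ 2 := by positivity
  have hRneg : R < 0 := by
    by_contra hcon
    nlinarith
  have hQ0 : 0 ≤ Q := by
    nlinarith only [hQ, sq_nonneg (u - v), sq_nonneg (u - w), sq_nonneg (v - w)]
  have hQle : Q ≤ 4908 := by
    have : R * 327.2 ≤ -(7 / 3) := by nlinarith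
    nlinarith
  have hub := abs_lt.1 (abs_lt_of_sum_and_form_le h1 hRneg hQle)
  have hvb := abs_lt.1 (abs_lt_of_sum_and_form_le (u := v) (v := u) (w := w) (by linarith)
    (by linarith) (by linarith))
  have hwb := abs_lt.1 (abs_lt_of_sum_and_form_le (u := w) (v := u) (w := v) (by linarith)
    (by linarith) (by linarith))
  clear_value R Q
  have hx1 : x < 48 := by
    have : (x : ℝ) < 48 := by linarith [hub.2]
    exact_mod_cast this
  have hx2 : -48 < x := by
    have : (-48 : ℝ) < x := by linarith [hub.1]
    exact_mod_cast this
  have hk1 : k < 5 := by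
    by_contra hcon
    have : (5 : ℝ) ≤ k := by exact_mod_cast not_lt.1 hcon
    nlinarith only [this, hvb.2, hv, hθ1]
  have hk2 : -5 < k := by
    by_contra hcon
    have : (k : ℝ) ≤ -5 := by exact_mod_cast not_lt.1 hcon
    nlinarith only [this, hvb.1, hv, hθ1]
  have hθsq' : 3.3 < θ ^ 2 := by nlinarith only [hθ1]
  have hz1 : z < 15 := by
    by_contra hcon
    have : (15 : ℝ) ≤ z := by exact_mod_cast not_lt.1 hcon
    nlinarith only [this, hwb.2, hw, hθsq']
  have hz2 : -15 < z := by
    by_contra hcon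
    have : (z : ℝ) ≤ -15 := by exact_mod_cast not_lt.1 hcon
    nlinarith only [this, hwb.1, hw, hθsq']
  rcases norm_eq_neg_thirtyfive_bounded x (by rw [Finset.mem_Icc]; omega) k
    (by rw [Finset.mem_Icc]; omega) z (by rw [Finset.mem_Icc]; omega) hN with
    ⟨rfl, rfl, rfl⟩ | ⟨rfl, rfl, rfl⟩ | ⟨rfl, rfl, rfl⟩ | ⟨rfl, rfl, rfl⟩
  · exact ⟨0, Or.inl (by simp)⟩
  · exact ⟨1, Or.inl (by rw [pow_one, unitMatrix_mulVec]; norm_num)⟩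
  · exact ⟨0, Or.inr (by simp)⟩
  · exact ⟨1, Or.inr (by rw [pow_one, unitMatrix_mulVec]; norm_num)⟩

theorem exists_unitMatrix_pow {θ : ℝ} (hθ : θ ^ 3 = 6) (hθ1 : 1.817 < θ) (hθ2 : θ < 1.818) (n : ℕ) :
    ∀ x k z : ℤ, x ^ 3 + 6 * (6 * k) ^ 3 + 36 * z ^ 3 - 18 * x * (6 * k) * z = -35 →
    -(7 / 3) ≤ x + 6 * k * θ + z * θ ^ 2 →
    (x + 6 * k * θ + z * θ ^ 2) * (109 + 60 * θ + 33 * θ ^ 2) ^ (n + 1) ≤ -(7 / 3) →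
    ∃ m : ℕ, ![x, 6 * k, z] = (unitMatrix ^ m).mulVec ![1, 0, -1] ∨
      ![x, 6 * k, z] = (unitMatrix ^ m).mulVec ![-11, -6, -3] := by
  have hK1 : 1 ≤ 109 + 60 * θ + 33 * θ ^ 2 := by nlinarith
  induction n with
  | zero =>
    intro x k z hN h1 h2
    exact exists_unitMatrix_pow_of_range hθ hθ1 hθ2 hN h1 (by simpa using h2)
  | succ n ih =>
    intro x k z hN h1 h2
    by_cases hc : (x + 6 * k * θ + z * θ ^ 2) * (109 + 60 * θ + 33 * θ ^ 2) ^ (n + 1) ≤ -(7 / 3)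
    · exact ih x k z hN h1 hc
    push Not at hc
    have hstep : ((109 * x + 198 * (6 * k) + 360 * z : ℤ) : ℝ)
        + 6 * ((10 * x + 109 * k + 33 * z : ℤ) : ℝ) * θ
        + ((33 * x + 60 * (6 * k) + 109 * z : ℤ) : ℝ) * θ ^ 2
        = (x + 6 * k * θ + z * θ ^ 2) * (109 + 60 * θ + 33 * θ ^ 2) := by
      push_cast
      linear_combination (-(198 * k + 60 * z) - 33 * z * θ : ℝ) * hθ
    obtain ⟨m, hm⟩ := ih (109 * x + 198 * (6 * k) + 360 * z) (10 * x + 109 * k + 33 * z)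
      (33 * x + 60 * (6 * k) + 109 * z) (by linear_combination hN)
      (by
        rw [hstep]
        have hneg : x + 6 * k * θ + z * θ ^ 2 < 0 := by
          by_contra hcon
          push Not at hcon
          have := mul_nonneg hcon (pow_nonneg (zero_le_one.trans hK1) (n + 1 + 1))
          linarith
        refine hc.le.trans ?_
        refine mul_le_mul_of_nonpos_left ?_ hneg.le
        exact le_self_pow₀ hK1 (by omega))
      (by rw [hstep, mul_assoc, ← pow_succ']; exact h2)
    have hE : ![x, 6 * k, z] = unitMatrix.mulVec ![109 * x + 198 * (6 * k) + 360 * z,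
        6 * (10 * x + 109 * k + 33 * z), 33 * x + 60 * (6 * k) + 109 * z] := by
      rw [unitMatrix_mulVec]
      congr! 1
      · ring
      · congr! 1
        · ring
        · congr! 1
          ring
    refine ⟨m + 1, ?_⟩
    rw [pow_succ', ← Matrix.mulVec_mulVec, ← Matrix.mulVec_mulVec, hE]
    exact hm.imp (fun h => by rw [h]) (fun h => by rw [h])

theorem one_add_three_mul_pow {R : Type*} [CommRing R] (a : R) (k m : ℕ) :
    ∃ b, (1 + 3 * a) ^ (3 ^ k * m) = 1 + 3 ^ (k + 1) * (m * a + 3 * b) := by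
  have hk : ∃ b, (1 + 3 * a) ^ (3 ^ k) = 1 + 3 ^ (k + 1) * (a + 3 * b) := by
    induction k with
    | zero => exact ⟨0, by ring⟩
    | succ k ih =>
      obtain ⟨b, hb⟩ := ih
      refine ⟨b + 3 ^ k * (a + 3 * b) ^ 2 + 3 ^ (2 * k) * (a + 3 * b) ^ 3, ?_⟩
      rw [pow_succ 3 k, pow_mul, hb]
      ring
  obtain ⟨b, hb⟩ := hk
  rw [pow_mul, hb]
  induction m with
  | zero => exact ⟨0, by simp⟩
  | succ m ih =>
    obtain ⟨c, hc⟩ := ih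
    refine ⟨c + b + 3 ^ k * (m * a + 3 * c) * (a + 3 * b), ?_⟩
    rw [pow_succ, hc]
    push_cast
    ring

theorem unitMatrix_pow_mulVec_principal {n : ℕ}
    (h : (unitMatrix ^ n).mulVec ![1, 0, -1] 1 = 0) : n = 0 := by
  by_contra hn
  obtain ⟨k, m, hm, rfl⟩ := Nat.exists_eq_pow_mul_and_not_dvd hn 3 (by norm_num)
  obtain ⟨b, hb⟩ := one_add_three_mul_pow (X : ℤ[X]) k m
  set δ : Matrix (Fin 3) (Fin 3) ℤ := !![0, 6, -12; -2, 0, 6; 1, -2, 0] with hδ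
  have hE : unitMatrix = 1 + (3 : ℤ) • δ := by
    ext i j
    fin_cases i <;> fin_cases j <;> simp [unitMatrix, hδ]
  have hb' : unitMatrix ^ (3 ^ k * m) =
      1 + (3 : ℤ) ^ (k + 1) • ((m : ℤ) • δ + (3 : ℤ) • aeval δ b) := by
    have := congrArg (aeval δ) hb
    simp only [map_pow, map_add, map_mul, map_one, aeval_X, map_natCast, map_ofNat] at this
    rw [hE]
    simp only [zsmul_eq_mul]
    push_cast
    exact this
  rw [hb'] at h
  simp only [Matrix.add_mulVec, Matrix.smul_mulVec, Matrix.one_mulVec, Pi.add_apply,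
    Pi.smul_apply, smul_eq_mul] at h
  have h8 : δ.mulVec ![1, 0, -1] 1 = -8 := by
    simp [hδ, Matrix.mulVec, dotProduct, Fin.sum_univ_three]
  rw [h8] at h
  have h3 : (3 : ℤ) ^ (k + 1) ≠ 0 := by positivity
  have h0 : (m : ℤ) * -8 + 3 * (aeval δ b).mulVec ![1, 0, -1] 1 = 0 := by
    simpa using h
  omega

theorem unitMatrix_pow_mulVec_ne (n : ℕ) : (unitMatrix ^ n).mulVec ![-11, -6, -3] 1 ≠ 0 := by
  have key : ∀ n : ℕ, ∃ x y z : ℤ, (unitMatrix ^ n).mulVec ![-11, -6, -3] = ![x, y, z] ∧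
      ((x : ZMod 7), (y : ZMod 7), (z : ZMod 7)) ∈ [((3 : ZMod 7), (1 : ZMod 7), (4 : ZMod 7)),
        (3, 6, 0), (6, 2, 1), (6, 5, 0), (5, 4, 2), (5, 3, 0)] := by
    intro n
    induction n with
    | zero => exact ⟨-11, -6, -3, by simp, by decide⟩
    | succ n ih =>
      obtain ⟨x, y, z, h, hmem⟩ := ih
      refine ⟨_, _, _, by rw [pow_succ', ← Matrix.mulVec_mulVec, h, unitMatrix_mulVec], ?_⟩
      push_cast
      revert hmem
      generalize (x : ZMod 7) = x
      generalize (y : ZMod 7) = y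
      generalize (z : ZMod 7) = z
      revert x y z
      decide
  obtain ⟨x, y, z, h, hmem⟩ := key n
  rw [h]
  intro h0
  have h0' : y = 0 := by simpa using h0
  rw [h0'] at hmem
  revert hmem
  push_cast
  generalize (x : ZMod 7) = x
  generalize (z : ZMod 7) = z
  revert x z
  decide

theorem eq_one_of_cube_add_thirtyfive {s b : ℤ} (hs : 0 < s) (h : s ^ 3 + 35 = 36 * b ^ 3) :
    s = 1 := by
  obtain ⟨θ, hθ0, hθ⟩ : ∃ θ : ℝ, 0 ≤ θ ∧ θ ^ 3 = 6 :=
    ⟨6 ^ ((3 : ℝ)⁻¹), by positivity, by rw [← Real.rpow_natCast, ← Real.rpow_mul] <;> norm_num⟩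
  have hθ1 : 1.817 < θ := lt_of_pow_lt_pow_left₀ 3 hθ0 (by rw [hθ]; norm_num)
  have hθ2 : θ < 1.818 := lt_of_pow_lt_pow_left₀ 3 (by norm_num) (by rw [hθ]; norm_num)
  have hb : 0 < b := by
    by_contra hb
    push Not at hb
    have : b ^ 3 ≤ 0 := Odd.pow_nonpos (by decide) hb
    have : 0 < s ^ 3 := by positivity
    omega
  have hs1 : (1 : ℝ) ≤ s := by exact_mod_cast hs
  have hb1 : (1 : ℝ) ≤ b := by exact_mod_cast hb
  have hθsq : 3.3 < θ ^ 2 := by nlinarith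
  have hfac : ((s : ℝ) - b * θ ^ 2) * (s ^ 2 + s * (b * θ ^ 2) + (b * θ ^ 2) ^ 2) = -35 := by
    have h' : (s : ℝ) ^ 3 + 35 = 36 * b ^ 3 := by exact_mod_cast h
    linear_combination h' - (b : ℝ) ^ 3 * (θ ^ 3 + 6) * hθ
  have hw : 3.3 ≤ b * θ ^ 2 := by nlinarith
  have hQ : 15 ≤ (s : ℝ) ^ 2 + s * (b * θ ^ 2) + (b * θ ^ 2) ^ 2 := by nlinarith
  have hneg : (s : ℝ) - b * θ ^ 2 < 0 := by
    by_contra hcon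
    push Not at hcon
    have := mul_nonneg hcon (by linarith : 0 ≤ (s : ℝ) ^ 2 + s * (b * θ ^ 2) + (b * θ ^ 2) ^ 2)
    linarith
  have hlow : -(7 / 3) ≤ (s : ℝ) - b * θ ^ 2 := by
    by_contra hcon
    push Not at hcon
    nlinarith
  obtain ⟨n, hn⟩ := pow_unbounded_of_one_lt (-(7 / 3) / ((s : ℝ) - b * θ ^ 2))
    (by nlinarith : 1 < 109 + 60 * θ + 33 * θ ^ 2)
  have hK1 : 1 ≤ 109 + 60 * θ + 33 * θ ^ 2 := by nlinarith
  rw [div_lt_iff_of_neg hneg] at hn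
  obtain ⟨m, hm | hm⟩ := exists_unitMatrix_pow hθ hθ1 hθ2 n s 0 (-b) (by linear_combination h)
    (by push_cast; linarith)
    (by
      have : (109 + 60 * θ + 33 * θ ^ 2) ^ n ≤ (109 + 60 * θ + 33 * θ ^ 2) ^ (n + 1) :=
        pow_le_pow_right₀ hK1 (by omega)
      have := mul_le_mul_of_nonpos_left this hneg.le
      push_cast
      linarith)
  · have h0 := unitMatrix_pow_mulVec_principal (n := m) (by rw [← hm]; simp)
    subst h0
    simpa using congrFun hm 0
  · exact absurd (by rw [← hm]; simp) (unitMatrix_pow_mulVec_ne m)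

end CubicEquation

/-! ### Squares in Pell sequences -/

section PellEquation

open Pell NumberTheorySymbols

/-- The residues modulo `p` of the coordinates of the `n`-th power of the solution `(t, u)` of
the Pell equation `x² - d y² = 1`. -/
def pellMod (d t u p : ℕ) : ℕ → ℕ × ℕ
  | 0 => (1 % p, 0)
  | n + 1 => ((t * (pellMod d t u p n).1 + d * (u * (pellMod d t u p n).2)) % p,
      (t * (pellMod d t u p n).2 + u * (pellMod d t u p n).1) % p)

/-- The residue modulo `p` of `x + 6 y` for the `n`-th power `(x, y)` of the solution `(t, u)` of
the Pell equation `x² - d y² = 1`. -/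
def pellTerm (d t u p n : ℕ) : ℕ := ((pellMod d t u p n).1 + 6 * (pellMod d t u p n).2) % p

/-- The value `x + 6 y` at a solution `(x, y)` of a Pell equation. -/
def pellValue {d : ℤ} (a : Solution₁ d) : ℤ := a.x + 6 * a.y

theorem pow_cast_eq_pellMod {d t u : ℕ} {g : Solution₁ (d : ℤ)} (hx : g.x = t) (hy : g.y = u)
    (p n : ℕ) : ((g ^ n).x : ZMod p) = (pellMod d t u p n).1 ∧
      ((g ^ n).y : ZMod p) = (pellMod d t u p n).2 := by
  induction n with
  | zero => simp [pellMod]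
  | succ n ih =>
    rw [pow_succ', Solution₁.x_mul, Solution₁.y_mul, hx, hy]
    constructor
    · push_cast [pellMod]
      rw [ih.1, ih.2, ZMod.natCast_mod]
      push_cast
      ring
    · push_cast [pellMod]
      rw [ih.1, ih.2, ZMod.natCast_mod]
      push_cast
      ring

/-- The solutions of a Pell equation congruent to `1` modulo `M`. -/
def pellCongruenceSubgroup (d M : ℤ) : Subgroup (Solution₁ d) where
  carrier := {a | M ∣ a.x - 1 ∧ M ∣ a.y}
  one_mem' := by simp
  mul_mem' := by
    rintro a b ⟨⟨r, hr⟩, s, hs⟩ ⟨⟨r', hr'⟩, s', hs'⟩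
    constructor
    · refine ⟨r * b.x + r' + d * (s * b.y), ?_⟩
      rw [Solution₁.x_mul]
      linear_combination b.x * hr + hr' + d * b.y * hs
    · refine ⟨a.x * s' + s * b.x, ?_⟩
      rw [Solution₁.y_mul]
      linear_combination a.x * hs' + b.x * hs
  inv_mem' := by
    rintro a ⟨h1, h2⟩
    exact ⟨by simpa using h1, by simpa using h2⟩

theorem dvd_pellValue_mul_sub {d M : ℤ} {h : Solution₁ d} (hh : h ∈ pellCongruenceSubgroup d M)
    (a : Solution₁ d) : M ∣ pellValue (h * a) - pellValue a := by
  obtain ⟨⟨r, hr⟩, s, hs⟩ := hh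
  refine ⟨r * a.x + d * (s * a.y) + 6 * (r * a.y + s * a.x), ?_⟩
  rw [pellValue, pellValue, Solution₁.x_mul, Solution₁.y_mul]
  linear_combination (a.x + 6 * a.y) * hr + (d * a.y + 6 * a.x) * hs

theorem pellValue_zpow_cast {d t u : ℕ} {g : Solution₁ (d : ℤ)} (hx : g.x = t) (hy : g.y = u)
    {p P : ℕ} (hP : 0 < P) (h : pellMod d t u p P = (1 % p, 0)) (n : ℤ) :
    (pellValue (g ^ n) : ZMod p) = pellTerm d t u p (n % P).toNat := by
  have hper : g ^ P ∈ pellCongruenceSubgroup (d : ℤ) (p : ℤ) := by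
    obtain ⟨h1, h2⟩ := pow_cast_eq_pellMod hx hy p P
    rw [h] at h1 h2
    constructor
    · rw [← ZMod.intCast_zmod_eq_zero_iff_dvd]
      push_cast
      rw [h1]
      simp
    · rw [← ZMod.intCast_zmod_eq_zero_iff_dvd, h2]
      simp
  have hdvd := dvd_pellValue_mul_sub (zpow_mem hper (n / P)) (g ^ (n % P).toNat)
  have hsplit : (g ^ P) ^ (n / P) * g ^ (n % P).toNat = g ^ n := by
    rw [← zpow_natCast, ← zpow_natCast, ← zpow_mul, ← zpow_add,
      Int.toNat_of_nonneg (Int.emod_nonneg _ (by omega)), Int.mul_ediv_add_emod]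
  rw [hsplit, ← ZMod.intCast_zmod_eq_zero_iff_dvd, Int.cast_sub, sub_eq_zero] at hdvd
  obtain ⟨h1, h2⟩ := pow_cast_eq_pellMod hx hy p (n % P).toNat
  rw [hdvd, pellValue, pellTerm, ZMod.natCast_mod]
  push_cast
  rw [h1, h2]

/-- Whether `x + 6 y` may be a square for the `r`-th power of the solution `(t, u)`, according to
Euler's criterion modulo the first components of the given pairs (prime, period). -/
def pellSieve (d t u : ℕ) (L : List (ℕ × ℕ)) (r : ℕ) : Bool :=
  L.all fun q => pellTerm d t u q.1 (r % q.2) ^ ((q.1 - 1) / 2) % q.1 != q.1 - 1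

theorem pellSieve_of_eq_sq {d t u : ℕ} {g : Solution₁ (d : ℤ)} (hx : g.x = t) (hy : g.y = u)
    {L : List (ℕ × ℕ)} {N : ℕ} (hN : 0 < N) (hprime : ∀ q ∈ L, q.1.Prime)
    (hL : ∀ q ∈ L, 2 < q.1 ∧ q.2 ∣ N ∧ pellMod d t u q.1 q.2 = (1 % q.1, 0)) {n a : ℤ}
    (h : pellValue (g ^ n) = a ^ 2) : pellSieve d t u L (n % N).toNat = true := by
  rw [pellSieve, List.all_eq_true]
  rintro ⟨p, P⟩ hq
  obtain ⟨hp2, hPN, hper⟩ := hL _ hq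
  have hp := hprime _ hq
  simp only at hp2 hPN hper hp ⊢
  have : Fact p.Prime := ⟨hp⟩
  have hP : 0 < P := Nat.pos_of_dvd_of_pos hPN hN
  have hcast := pellValue_zpow_cast hx hy hP hper n
  have hr : (n % N).toNat % P = (n % P).toNat := by
    have h1 : (0 : ℤ) ≤ n % N := Int.emod_nonneg _ (by omega)
    have h2 : (0 : ℤ) ≤ n % P := Int.emod_nonneg _ (by omega)
    zify
    rw [Int.toNat_of_nonneg h1, Int.toNat_of_nonneg h2]
    exact Int.emod_emod_of_dvd _ (by exact_mod_cast hPN)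
  rw [hr, bne_iff_ne]
  intro hcon
  rw [h] at hcast
  have hpow : ((a : ZMod p) ^ 2) ^ ((p - 1) / 2) = -1 := by
    push_cast at hcast
    rw [hcast, ← Nat.cast_pow, ← ZMod.natCast_mod, hcon, Nat.cast_sub hp.one_le]
    simp
  have hodd : 2 * ((p - 1) / 2) = p - 1 := by
    have := hp.eq_two_or_odd
    omega
  rw [← pow_mul, hodd] at hpow
  have hne : (1 : ZMod p) ≠ -1 := by
    have : Fact (2 < p) := ⟨hp2⟩
    exact (ZMod.neg_one_ne_one (n := p)).symm
  by_cases ha : (a : ZMod p) = 0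
  · rw [ha, zero_pow (by omega)] at hpow
    have : (1 : ZMod p) = 0 := by linear_combination hpow
    exact one_ne_zero this
  · rw [ZMod.pow_card_sub_one_eq_one ha] at hpow
    exact hne hpow

theorem exists_pellValue_of_sol {d p q t v : ℤ} {g : Solution₁ d} (hd : d = 3 * p) (hx : g.x = t)
    (hy : g.y = 2 * v) (hp : 0 < p) (hq : 0 < q) (ht : 1 < t) (hv : 0 < v)
    (hbound : (t - 1) * q < 50 * p)
    (hsmall : ∀ X b : ℤ, 0 < b → |X| < 5 → p * X ^ 2 + q = 12 * b ^ 2 → (X = 1 ∨ X = -1) ∧ b = 1)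
    (N : ℕ) : ∀ X b : ℤ, 0 < b → b ≤ N → p * X ^ 2 + q = 12 * b ^ 2 →
      ∃ n : ℤ, (X = pellValue (g ^ n) ∨ X = -pellValue (g ^ n)) ∧
        2 * b = 2 * (g ^ n).x + p * (g ^ n).y := by
  subst hd
  have htv : t ^ 2 - 12 * p * v ^ 2 = 1 := by
    have := g.prop
    rw [hx, hy] at this
    linear_combination this
  induction N with
  | zero => intro X b h1 h2; simp at h2; omega
  | succ N ih =>
    have main : ∀ X b : ℤ, 0 < X → 0 < b → b ≤ (N + 1 : ℕ) → p * X ^ 2 + q = 12 * b ^ 2 →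
        ∃ n : ℤ, (X = pellValue (g ^ n) ∨ X = -pellValue (g ^ n)) ∧
          2 * b = 2 * (g ^ n).x + p * (g ^ n).y := by
      intro X b hX hb hbN h
      by_cases hX5 : |X| < 5
      · obtain ⟨hX1, rfl⟩ := hsmall X b hb hX5 h
        exact ⟨0, by simpa [pellValue] using hX1, by simp⟩
      rw [abs_of_pos hX, not_lt] at hX5
      have hpos : 0 < t * b - p * v * X := by
        have h1 : (p * v * X) ^ 2 < (t * b) ^ 2 := by
          have : 12 * ((t * b) ^ 2 - (p * v * X) ^ 2) = p * X ^ 2 + t ^ 2 * q := by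
            linear_combination (-t ^ 2) * h + p * X ^ 2 * htv
          have : 0 < p * X ^ 2 + t ^ 2 * q := by positivity
          linarith
        have := abs_lt_of_sq_lt_sq h1 (by positivity)
        linarith [le_abs_self (p * v * X)]
      have hlt : t * b - p * v * X < b := by
        have h1 : ((t - 1) * b) ^ 2 < (p * v * X) ^ 2 := by
          have e : 12 * ((p * v * X) ^ 2 - ((t - 1) * b) ^ 2)
              = (t - 1) * (2 * p * X ^ 2 - (t - 1) * q) := by
            linear_combination (t - 1) ^ 2 * h - p * X ^ 2 * htv
          have h25 : 25 * p ≤ p * X ^ 2 := by nlinarith [pow_le_pow_left₀ (by norm_num) hX5 2]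
          have : 0 < (t - 1) * (2 * p * X ^ 2 - (t - 1) * q) :=
            mul_pos (by linarith) (by linarith)
          linarith
        have := abs_lt_of_sq_lt_sq h1 (by positivity)
        linarith [le_abs_self ((t - 1) * b)]
      obtain ⟨n, hn, hb'⟩ := ih (t * X - 12 * v * b) (t * b - p * v * X) hpos
        (by push_cast at hbN; omega) (by linear_combination (t ^ 2 - 12 * p * v ^ 2) * h - q * htv)
      have hXe : X = t * (t * X - 12 * v * b) + 12 * v * (t * b - p * v * X) := by
        linear_combination -X * htv
      have hbe : b = t * (t * b - p * v * X) + p * v * (t * X - 12 * v * b) := by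
        linear_combination -b * htv
      rcases hn with hn | hn
      · refine ⟨n + 1, Or.inl ?_, ?_⟩
        · rw [zpow_add_one, pellValue, Solution₁.x_mul, Solution₁.y_mul, hx, hy]
          rw [pellValue] at hn
          linear_combination hXe + t * hn + 6 * v * hb'
        · rw [zpow_add_one, Solution₁.x_mul, Solution₁.y_mul, hx, hy]
          rw [pellValue] at hn
          linear_combination 2 * hbe + t * hb' + 2 * p * v * hn
      · refine ⟨n - 1, Or.inr ?_, ?_⟩
        · rw [zpow_sub_one, pellValue, Solution₁.x_mul, Solution₁.y_mul, Solution₁.x_inv,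
            Solution₁.y_inv, hx, hy]
          rw [pellValue] at hn
          linear_combination hXe + t * hn + 6 * v * hb'
        · rw [zpow_sub_one, Solution₁.x_mul, Solution₁.y_mul, Solution₁.x_inv,
            Solution₁.y_inv, hx, hy]
          rw [pellValue] at hn
          linear_combination 2 * hbe + t * hb' + 2 * p * v * hn
    intro X b hb hbN h
    rcases lt_trichotomy X 0 with hX | rfl | hX
    · obtain ⟨n, hn, hn'⟩ := main (-X) b (by omega) hb hbN (by linear_combination h)
      exact ⟨n, by omega, hn'⟩
    · obtain ⟨h0, -⟩ := hsmall 0 b hb (by norm_num) h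
      omega
    · exact main X b hX hb hbN h

theorem jacobiSym_natAbs_swap {Z : ℤ} {c : ℕ} (hZ : Z % 4 = 1) (hc : Odd c) :
    jacobiSym c Z.natAbs = jacobiSym Z c := by
  rcases le_total 0 Z with h | h
  · obtain ⟨m, rfl⟩ := Int.eq_ofNat_of_zero_le h
    rw [Int.natAbs_natCast]
    exact jacobiSym.quadratic_reciprocity_one_mod_four' hc (by omega)
  · obtain ⟨m, rfl⟩ : ∃ m : ℕ, Z = -m := ⟨Z.natAbs, by omega⟩
    rw [Int.natAbs_neg, Int.natAbs_natCast, jacobiSym.neg _ hc]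
    have hm : m % 4 = 3 := by omega
    rcases Nat.odd_mod_four_iff.1 (Nat.odd_iff.1 hc) with hc1 | hc3
    · rw [ZMod.χ₄_nat_one_mod_four hc1, one_mul]
      exact jacobiSym.quadratic_reciprocity_one_mod_four hc1 (Nat.odd_iff.2 (by omega))
    · rw [ZMod.χ₄_nat_three_mod_four hc3, neg_one_mul]
      exact jacobiSym.quadratic_reciprocity_three_mod_four hc3 hm

theorem jacobiSym_ne_neg_one_of_dvd {a Z : ℤ} {M : ℕ} (hM : M % 4 = 1)
    (h : (M : ℤ) ∣ a ^ 2 - Z ∨ (M : ℤ) ∣ a ^ 2 + Z) : jacobiSym Z M ≠ -1 := by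
  have hodd : Odd M := Nat.odd_iff.2 (by omega)
  have key : ∀ Y : ℤ, (M : ℤ) ∣ a ^ 2 - Y → jacobiSym Y M ≠ -1 := by
    intro Y hY
    rw [← jacobiSym.mod_left' (Int.emod_eq_emod_iff_emod_sub_eq_zero.2
      (Int.emod_eq_zero_of_dvd hY)), jacobiSym.pow_left]
    nlinarith [sq_nonneg (jacobiSym a M)]
  rcases h with h | h
  · exact key Z h
  · have := key (-Z) (by simpa using h)
    rwa [jacobiSym.neg _ hodd, ZMod.χ₄_nat_one_mod_four hM, one_mul] at this

theorem Int.exists_eq_pow_mul_and_not_dvd {n : ℤ} (hn : n ≠ 0) {p : ℕ} (hp : p ≠ 1) :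
    ∃ (k : ℕ) (m : ℤ), n = p ^ k * m ∧ ¬ (p : ℤ) ∣ m := by
  obtain ⟨k, m, hm, h⟩ := Nat.exists_eq_pow_mul_and_not_dvd (Int.natAbs_ne_zero.2 hn) p hp
  rcases Int.natAbs_eq n with e | e
  · exact ⟨k, m, by rw [e, h]; push_cast; ring, by exact_mod_cast hm⟩
  · exact ⟨k, -m, by rw [e, h]; push_cast; ring, by rw [dvd_neg]; exact_mod_cast hm⟩

theorem dvd_pellValue_zpow_mul {d M : ℤ} {h a : Solution₁ d}
    (hh : -h ∈ pellCongruenceSubgroup d M) (q : ℤ) :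
    M ∣ pellValue (h ^ q * a) - pellValue a ∨ M ∣ pellValue (h ^ q * a) + pellValue a := by
  have hmem := zpow_mem hh q
  have hneg : pellValue (-a) = -pellValue a := by simp [pellValue]; ring
  rcases Int.even_or_odd q with hq | hq
  · rw [hq.neg_zpow] at hmem
    exact Or.inl (dvd_pellValue_mul_sub hmem a)
  · rw [hq.neg_zpow] at hmem
    have := dvd_pellValue_mul_sub hmem (-a)
    rw [neg_mul_neg, hneg, sub_neg_eq_add] at this
    exact Or.inr this

theorem neg_sq_mem_pellCongruenceSubgroup {d M : ℤ} {h : Solution₁ d} (hM : M ∣ h.x) :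
    -h ^ 2 ∈ pellCongruenceSubgroup d M := by
  obtain ⟨r, hr⟩ := hM
  have hp := h.prop
  constructor
  · refine ⟨-(2 * r * h.x), ?_⟩
    rw [Solution₁.x_neg, sq, Solution₁.x_mul]
    linear_combination hp - 2 * h.x * hr
  · refine ⟨-(2 * r * h.y), ?_⟩
    rw [Solution₁.y_neg, sq, Solution₁.y_mul]
    linear_combination -2 * h.y * hr

theorem pellValue_zpow_emod {d t u : ℕ} {g : Solution₁ (d : ℤ)} (hx : g.x = t) (hy : g.y = u)
    {p P r c : ℕ} (hp : 0 < p) (hP : 0 < P) (h : pellMod d t u p P = (1 % p, 0)) {n : ℤ}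
    (hr : n % P = r) (hc : pellTerm d t u p r = c) : pellValue (g ^ n) % p = c := by
  have hcast := pellValue_zpow_cast hx hy hP h n
  rw [hr, Int.toNat_natCast, hc] at hcast
  have hlt : c < p := by rw [← hc]; exact Nat.mod_lt _ hp
  have := (ZMod.intCast_eq_intCast_iff' (pellValue (g ^ n)) c p).1 (by exact_mod_cast hcast)
  exact this.trans (Int.emod_eq_of_lt (by omega) (by exact_mod_cast hlt))

theorem x_sq_mul {d : ℤ} (h a : Solution₁ d) : (h ^ 2 * a).x = 2 * h.x * (h * a).x - a.x := by
  rw [sq]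
  simp only [Solution₁.x_mul, Solution₁.y_mul]
  linear_combination -a.x * h.prop

theorem x_sq {d : ℤ} (h : Solution₁ d) : (h ^ 2).x = 2 * h.x ^ 2 - 1 := by
  have := x_sq_mul h 1
  simp only [mul_one, Solution₁.x_one] at this
  rw [this]
  ring

theorem x_pow_seven {d : ℤ} (h : Solution₁ d) :
    (h ^ 7).x = h.x * (64 * h.x ^ 6 - 112 * h.x ^ 4 + 56 * h.x ^ 2 - 7) := by
  have e (n : ℕ) : (h ^ (n + 2)).x = 2 * h.x * (h ^ (n + 1)).x - (h ^ n).x := by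
    have := x_sq_mul h (h ^ n)
    rwa [← pow_add, ← pow_succ', add_comm 2 n] at this
  rw [e 5, e 4, e 3, e 2, e 1, e 0]
  simp only [zero_add, pow_one, pow_zero, Solution₁.x_one]
  ring

/-- The fundamental solution `(31, 8)` of `x² - 15 y² = 1`. -/
def pellFifteen : Solution₁ ((15 : ℕ) : ℤ) := Solution₁.mk 31 8 (by norm_num)

/-- The fundamental solution `(55, 12)` of `x² - 21 y² = 1`. -/
def pellTwentyOne : Solution₁ ((21 : ℕ) : ℤ) := Solution₁.mk 55 12 (by norm_num)

theorem pellFifteen_x : pellFifteen.x = (31 : ℕ) := rfl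
theorem pellFifteen_y : pellFifteen.y = (8 : ℕ) := rfl
theorem pellTwentyOne_x : pellTwentyOne.x = (55 : ℕ) := rfl
theorem pellTwentyOne_y : pellTwentyOne.y = (12 : ℕ) := rfl

theorem odd_x_of_odd_pellValue {d : ℤ} {a : Solution₁ d} (h : Odd (pellValue a)) : Odd a.x := by
  rw [pellValue] at h
  rcases Int.even_or_odd a.x with h' | h'
  · exact absurd (h'.add (by simp [show Even (6 : ℤ) by decide]))
      (Int.not_even_iff_odd.2 h)
  · exact h'

theorem isCoprime_three_pellValue {d : ℤ} {a : Solution₁ d} (hd : 3 ∣ d) :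
    IsCoprime (pellValue a) 3 := by
  obtain ⟨e, rfl⟩ := hd
  refine ⟨a.x - 6 * a.y, 12 * a.y ^ 2 - e * a.y ^ 2, ?_⟩
  rw [pellValue]
  linear_combination a.prop

theorem jacobiSym_eq_of_dvd {a b Z : ℤ} (h : Z ∣ a - b) :
    jacobiSym a Z.natAbs = jacobiSym b Z.natAbs :=
  jacobiSym.mod_left' (Int.emod_eq_emod_iff_emod_sub_eq_zero.2
    (Int.emod_eq_zero_of_dvd (Int.natAbs_dvd.2 h)))

theorem pellFifteen_zpow_ne_sq {κ q a : ℤ} (h4 : 4 ∣ κ) (h3 : ¬ 3 ∣ κ) :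
    pellValue (pellFifteen ^ (14 * κ * q + κ)) ≠ a ^ 2 := by
  intro ha
  set h := pellFifteen ^ κ with hh
  set Z := pellValue h with hZ
  have emod {p P r c : ℕ} (hp : 0 < p) (hP : 0 < P) (hper : pellMod 15 31 8 p P = (1 % p, 0))
      (hr : κ % P = r) (hc : pellTerm 15 31 8 p r = c) : Z % p = c :=
    pellValue_zpow_emod pellFifteen_x pellFifteen_y hp hP hper hr hc
  have hZ4 : Z % 4 = 1 := emod (p := 4) (P := 2) (r := 0) (c := 1) (by norm_num) (by norm_num)
    (by decide) (by omega) (by decide)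
  set T := h.x with hT
  have hTodd : T % 2 = 1 := Int.odd_iff.1 (odd_x_of_odd_pellValue (Int.odd_iff.2 (by omega)))
  obtain ⟨M, hM⟩ : ∃ M : ℕ, (M : ℤ) = 64 * T ^ 6 - 112 * T ^ 4 + 56 * T ^ 2 - 7 := by
    refine ⟨(64 * T ^ 6 - 112 * T ^ 4 + 56 * T ^ 2 - 7).toNat, Int.toNat_of_nonneg ?_⟩
    have hT1 : 1 ≤ T ^ 2 := by
      have : 0 < T ^ 2 := by have : T ≠ 0 := by rintro e; omega
                             positivity
      omega
    nlinarith [mul_nonneg (sub_nonneg.2 hT1) (sq_nonneg (8 * T ^ 2 - 3))]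
  have hM4 : M % 4 = 1 := by
    have hTT : T ^ 2 % 4 = 1 := by
      rw [pow_two, Int.mul_emod]
      rcases (by omega : T % 4 = 1 ∨ T % 4 = 3) with e | e <;> rw [e] <;> rfl
    omega
  have hModd : Odd M := Nat.odd_iff.2 (by omega)
  have hcong : -(h ^ 7) ^ 2 ∈ pellCongruenceSubgroup _ (M : ℤ) := by
    refine neg_sq_mem_pellCongruenceSubgroup ?_
    rw [x_pow_seven, ← hT, ← hM]
    exact dvd_mul_left _ _
  have hdvd := dvd_pellValue_zpow_mul (a := h) hcong q
  have hpow : ((h ^ 7) ^ 2) ^ q * h = pellFifteen ^ (14 * κ * q + κ) := by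
    rw [hh, zpow_add, ← pow_mul, ← zpow_natCast, ← zpow_mul, ← zpow_mul]
    congr 2
    push_cast
    ring
  rw [hpow, ha] at hdvd
  refine jacobiSym_ne_neg_one_of_dvd hM4 hdvd ?_
  rw [← jacobiSym_natAbs_swap hZ4 hModd]
  have hdvd7 : Z ∣ 7 * T ^ 2 - 12 := by
    refine (isCoprime_three_pellValue (a := h) (by norm_num)).dvd_of_dvd_mul_left ?_
    refine ⟨-15 * (T - 6 * h.y), ?_⟩
    rw [pellValue]
    linear_combination 36 * h.prop
  have hdvdM : Z ∣ 7 ^ 3 * M - 13 ^ 2 * 167 := by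
    refine hdvd7.trans ⟨64 * (7 * T ^ 2) ^ 2 - 16 * (7 * T ^ 2) + 2552, ?_⟩
    rw [hM]
    ring
  have hJ := jacobiSym_eq_of_dvd hdvdM
  rw [jacobiSym.mul_left, jacobiSym.mul_left, jacobiSym.pow_left, jacobiSym.pow_left] at hJ
  have h7 : jacobiSym 7 Z.natAbs = 1 := by
    refine (jacobiSym_natAbs_swap (c := 7) hZ4 (by decide)).trans ?_
    rw [jacobiSym.mod_left]
    have hr : κ % 3 = 1 ∨ κ % 3 = 2 := by omega
    rcases hr with hr | hr
    · rw [emod (p := 7) (P := 3) (r := 1) (c := 2) (by norm_num) (by norm_num) (by decide)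
        hr (by decide)]
      norm_num
    · rw [emod (p := 7) (P := 3) (r := 2) (c := 4) (by norm_num) (by norm_num) (by decide)
        hr (by decide)]
      norm_num
  have h167 : jacobiSym 167 Z.natAbs = -1 := by
    refine (jacobiSym_natAbs_swap (c := 167) hZ4 (by decide)).trans ?_
    rw [jacobiSym.mod_left]
    have hr : κ % 12 = 4 ∨ κ % 12 = 8 := by omega
    rcases hr with hr | hr
    · rw [emod (p := 167) (P := 12) (r := 4) (c := 53) (by norm_num) (by norm_num) (by decide)
        hr (by decide)]
      norm_num
    · rw [emod (p := 167) (P := 12) (r := 8) (c := 113) (by norm_num) (by norm_num) (by decide)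
        hr (by decide)]
      norm_num
  have h13 : jacobiSym 13 Z.natAbs ^ 2 = 1 := by
    have h13' : ¬ (13 : ℤ) ∣ Z := by
      have key : ∀ r < 7, pellTerm 15 31 8 13 r ≠ 0 := by decide
      have hr0 : 0 ≤ κ % 7 := Int.emod_nonneg _ (by norm_num)
      have := emod (p := 13) (P := 7) (r := (κ % 7).toNat) (by norm_num) (by norm_num) (by decide)
        (Int.toNat_of_nonneg hr0).symm rfl
      have := key (κ % 7).toNat (by omega)
      push_cast at *
      omega
    refine jacobiSym.sq_one ?_
    change Nat.Coprime 13 Z.natAbs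
    rw [Nat.Prime.coprime_iff_not_dvd (by norm_num)]
    omega
  rw [h7, h13, h167] at hJ
  linarith

theorem pellTwentyOne_zpow_ne_sq {κ q a : ℤ} (h4 : 4 ∣ κ) (h10 : κ % 10 = 8) :
    pellValue (pellTwentyOne ^ (4 * κ * q + κ)) ≠ a ^ 2 := by
  intro ha
  set h := pellTwentyOne ^ κ with hh
  set Z := pellValue h with hZ
  have emod {p P r c : ℕ} (hp : 0 < p) (hP : 0 < P) (hper : pellMod 21 55 12 p P = (1 % p, 0))
      (hr : κ % P = r) (hc : pellTerm 21 55 12 p r = c) : Z % p = c :=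
    pellValue_zpow_emod pellTwentyOne_x pellTwentyOne_y hp hP hper hr hc
  have hZ4 : Z % 4 = 1 := emod (p := 4) (P := 2) (r := 0) (c := 1) (by norm_num) (by norm_num)
    (by decide) (by omega) (by decide)
  set T := h.x with hT
  have hTodd : T % 2 = 1 := Int.odd_iff.1 (odd_x_of_odd_pellValue (Int.odd_iff.2 (by omega)))
  have hTT : T ^ 2 % 4 = 1 := by
    rw [pow_two, Int.mul_emod]
    rcases (by omega : T % 4 = 1 ∨ T % 4 = 3) with e | e <;> rw [e] <;> rfl
  obtain ⟨M, hM⟩ : ∃ M : ℕ, (M : ℤ) = 2 * T ^ 2 - 1 :=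
    ⟨(2 * T ^ 2 - 1).toNat, Int.toNat_of_nonneg (by have := sq_nonneg T; omega)⟩
  have hM4 : M % 4 = 1 := by omega
  have hModd : Odd M := Nat.odd_iff.2 (by omega)
  have hcong : -(h ^ 2) ^ 2 ∈ pellCongruenceSubgroup _ (M : ℤ) := by
    refine neg_sq_mem_pellCongruenceSubgroup ?_
    rw [x_sq, ← hT, ← hM]
  have hdvd := dvd_pellValue_zpow_mul (a := h) hcong q
  have hpow : ((h ^ 2) ^ 2) ^ q * h = pellTwentyOne ^ (4 * κ * q + κ) := by
    rw [hh, zpow_add, ← pow_mul, ← zpow_natCast, ← zpow_mul, ← zpow_mul]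
    congr 2
    push_cast
    ring
  rw [hpow, ha] at hdvd
  refine jacobiSym_ne_neg_one_of_dvd hM4 hdvd ?_
  rw [← jacobiSym_natAbs_swap hZ4 hModd]
  have hdvd5 : Z ∣ 5 * T ^ 2 - 12 := by
    refine (isCoprime_three_pellValue (a := h) (by norm_num)).dvd_of_dvd_mul_left ?_
    refine ⟨-21 * (T - 6 * h.y), ?_⟩
    rw [pellValue]
    linear_combination 36 * h.prop
  have hdvdM : Z ∣ 5 * M - 19 := by
    refine hdvd5.trans ⟨2, ?_⟩
    rw [hM]
    ring
  have hJ := jacobiSym_eq_of_dvd hdvdM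
  rw [jacobiSym.mul_left] at hJ
  have h5 : jacobiSym 5 Z.natAbs = 1 := by
    refine (jacobiSym_natAbs_swap (c := 5) hZ4 (by decide)).trans ?_
    rw [jacobiSym.mod_left, emod (p := 5) (P := 4) (r := 0) (c := 1) (by norm_num) (by norm_num)
      (by decide) (by omega) (by decide)]
    norm_num
  have h19 : jacobiSym 19 Z.natAbs = -1 := by
    refine (jacobiSym_natAbs_swap (c := 19) hZ4 (by decide)).trans ?_
    rw [jacobiSym.mod_left, emod (p := 19) (P := 10) (r := 8) (c := 10) (by norm_num)
      (by norm_num) (by decide) (by omega) (by decide)]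
    norm_num
  rw [h5, h19] at hJ
  linarith

theorem sq_emod_four (a : ℤ) : a ^ 2 % 4 = 0 ∨ a ^ 2 % 4 = 1 := by
  rw [pow_two, Int.mul_emod]
  rcases (by omega : a % 4 = 0 ∨ a % 4 = 1 ∨ a % 4 = 2 ∨ a % 4 = 3) with e | e | e | e <;>
    rw [e] <;> decide

theorem sq_emod_five (a : ℤ) : a ^ 2 % 5 = 0 ∨ a ^ 2 % 5 = 1 ∨ a ^ 2 % 5 = 4 := by
  rw [pow_two, Int.mul_emod]
  rcases (by omega : a % 5 = 0 ∨ a % 5 = 1 ∨ a % 5 = 2 ∨ a % 5 = 3 ∨ a % 5 = 4) with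
    e | e | e | e | e <;> rw [e] <;> decide

theorem sq_emod_seven (a : ℤ) :
    a ^ 2 % 7 = 0 ∨ a ^ 2 % 7 = 1 ∨ a ^ 2 % 7 = 2 ∨ a ^ 2 % 7 = 4 := by
  rw [pow_two, Int.mul_emod]
  rcases (by omega : a % 7 = 0 ∨ a % 7 = 1 ∨ a % 7 = 2 ∨ a % 7 = 3 ∨ a % 7 = 4 ∨ a % 7 = 5 ∨
    a % 7 = 6) with e | e | e | e | e | e | e <;> rw [e] <;> decide

/-- Pairs (prime, period) sieving the powers of `pellFifteen` modulo `600`. -/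
def sieveFifteen : List (ℕ × ℕ) :=
  [(5, 5), (11, 5), (23, 12), (29, 15), (31, 4), (47, 24), (449, 25), (1201, 300), (4801, 200)]

/-- Pairs (prime, period) sieving the powers of `pellTwentyOne` modulo `108`. -/
def sieveTwentyOne : List (ℕ × ℕ) :=
  [(11, 4), (37, 3), (53, 9), (109, 6), (163, 54), (379, 18), (1297, 108)]

set_option maxRecDepth 100000 in
theorem dvd_of_pellFifteen_zpow_eq_sq {n a : ℤ} (h : pellValue (pellFifteen ^ n) = a ^ 2) :
    600 ∣ n := by
  have heven : n % 2 = 0 := by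
    by_contra hn
    have := pellValue_zpow_emod pellFifteen_x pellFifteen_y (p := 4) (P := 2) (r := 1) (c := 3)
      (n := n) (by norm_num) (by norm_num) (by decide) (by omega) (by decide)
    have := sq_emod_four a
    push_cast at *
    omega
  have hs := pellSieve_of_eq_sq pellFifteen_x pellFifteen_y (L := sieveFifteen) (N := 600)
    (by norm_num) (by simp only [sieveFifteen, List.forall_mem_cons]; norm_num)
    (by decide +kernel) h
  have key : ∀ r < 600, r % 2 = 0 → pellSieve 15 31 8 sieveFifteen r = true → r = 0 := by
    decide +kernel
  have := key _ (by omega) (by omega) hs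
  push_cast at this
  omega

set_option maxRecDepth 100000 in
theorem dvd_of_pellTwentyOne_zpow_eq_sq {n a : ℤ} (h : pellValue (pellTwentyOne ^ n) = a ^ 2) :
    108 ∣ n := by
  have heven : n % 2 = 0 := by
    by_contra hn
    have := pellValue_zpow_emod pellTwentyOne_x pellTwentyOne_y (p := 4) (P := 2) (r := 1)
      (c := 3) (n := n) (by norm_num) (by norm_num) (by decide) (by omega) (by decide)
    have := sq_emod_four a
    push_cast at *
    omega
  have hs := pellSieve_of_eq_sq pellTwentyOne_x pellTwentyOne_y (L := sieveTwentyOne) (N := 108)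
    (by norm_num) (by simp only [sieveTwentyOne, List.forall_mem_cons]; norm_num)
    (by decide +kernel) h
  have key : ∀ r < 108, r % 2 = 0 → pellSieve 21 55 12 sieveTwentyOne r = true → r = 0 := by
    decide +kernel
  have := key _ (by omega) (by omega) hs
  push_cast at this
  omega

theorem pellFifteen_zpow_ne_neg_sq (n a : ℤ) : pellValue (pellFifteen ^ n) ≠ -a ^ 2 := by
  intro h
  have emod := @pellValue_zpow_emod _ _ _ _ pellFifteen_x pellFifteen_y 7 3
  have := sq_emod_seven a
  rcases (by omega : n % 3 = 0 ∨ n % 3 = 1 ∨ n % 3 = 2) with e | e | e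
  · have := emod (r := 0) (c := 1) (by norm_num) (by norm_num) (by decide) e (by decide)
    push_cast at *
    omega
  · have := emod (r := 1) (c := 2) (by norm_num) (by norm_num) (by decide) e (by decide)
    push_cast at *
    omega
  · have := emod (r := 2) (c := 4) (by norm_num) (by norm_num) (by decide) e (by decide)
    push_cast at *
    omega

theorem pellTwentyOne_zpow_ne_neg_sq (n a : ℤ) : pellValue (pellTwentyOne ^ n) ≠ -a ^ 2 := by
  intro h
  have emod {p P r c : ℕ} := @pellValue_zpow_emod _ _ _ _ pellTwentyOne_x pellTwentyOne_y p P r c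
  have := sq_emod_four a
  have := sq_emod_five a
  rcases (by omega : n % 2 = 0 ∨ n % 4 = 1 ∨ n % 4 = 3) with e | e | e
  · have := emod (p := 4) (P := 2) (r := 0) (c := 1) (by norm_num) (by norm_num) (by decide) e
      (by decide)
    push_cast at *
    omega
  · have := emod (p := 5) (P := 4) (r := 1) (c := 2) (by norm_num) (by norm_num) (by decide) e
      (by decide)
    push_cast at *
    omega
  · have := emod (p := 5) (P := 4) (r := 3) (c := 3) (by norm_num) (by norm_num) (by decide) e
      (by decide)
    push_cast at *
    omega

theorem eq_zero_of_pellFifteen_zpow_eq_sq {n a : ℤ} (h : pellValue (pellFifteen ^ n) = a ^ 2) :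
    n = 0 := by
  by_contra hn
  have hdvd := dvd_of_pellFifteen_zpow_eq_sq h
  obtain ⟨s, m', rfl, hm2⟩ := Int.exists_eq_pow_mul_and_not_dvd hn (p := 2) (by norm_num)
  obtain ⟨r, m, rfl, hm7⟩ := Int.exists_eq_pow_mul_and_not_dvd (right_ne_zero_of_mul hn) (p := 7)
    (by norm_num)
  push_cast at hdvd hm2 hm7 hn h
  have hm2' : ¬ (2 : ℤ) ∣ m := fun h => hm2 (h.mul_left _)
  have hs : (4 : ℤ) ∣ 2 ^ s := by
    have h4 : (2 : ℤ) ^ 2 ∣ 2 ^ s * (7 ^ r * m) := by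
      refine Dvd.dvd.trans ?_ hdvd
      norm_num
    exact (IsCoprime.pow_left ((Int.prime_two.coprime_iff_not_dvd).2 hm2)).dvd_of_dvd_mul_right h4
  have h25 : (25 : ℤ) ∣ m := by
    have hd : (25 : ℤ) ∣ 2 ^ s * (7 ^ r * m) := by
      refine Dvd.dvd.trans ?_ hdvd
      norm_num
    have h2 : IsCoprime (25 : ℤ) (2 ^ s) := IsCoprime.pow_right ⟨1, -12, by norm_num⟩
    have h7 : IsCoprime (25 : ℤ) (7 ^ r) := IsCoprime.pow_right ⟨2, -7, by norm_num⟩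
    exact h7.dvd_of_dvd_mul_left (h2.dvd_of_dvd_mul_left hd)
  have key (e : ℤ) (j : ℤ) (he : ¬ (3 : ℤ) ∣ e) (hj : j % 14 = 1) (hm : m = e * j) : False := by
    refine pellFifteen_zpow_ne_sq (κ := 2 ^ s * 7 ^ r * e) (q := j / 14) (a := a)
      ((hs.mul_right _).mul_right _) ?_ ?_
    · intro h3
      have h27 : (3 : ℤ) ∣ 2 ^ s * 7 ^ r := (Int.prime_three.dvd_or_dvd h3).resolve_right he
      rcases Int.prime_three.dvd_or_dvd h27 with h | h <;>
      · have := Int.prime_three.dvd_of_dvd_pow h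
        omega
    · rw [← h]
      congr 2
      rw [hm]
      have : j = 14 * (j / 14) + 1 := by omega
      linear_combination -(2 ^ s * 7 ^ r * e) * this
  obtain ⟨c, rfl⟩ := h25
  rcases (by omega : c % 14 = 9 ∨ c % 14 = 5 ∨ c % 14 = 3 ∨ c % 14 = 11 ∨
    c % 14 = 1 ∨ c % 14 = 13) with e | e | e | e | e | e
  · exact key 1 (25 * c) (by norm_num) (by omega) (by ring)
  · exact key (-1) (-(25 * c)) (by norm_num) (by omega) (by ring)
  · exact key 5 (5 * c) (by norm_num) (by omega) (by ring)
  · exact key (-5) (-(5 * c)) (by norm_num) (by omega) (by ring)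
  · exact key 25 c (by norm_num) e (by ring)
  · exact key (-25) (-c) (by norm_num) (by omega) (by ring)

theorem eq_zero_of_pellTwentyOne_zpow_eq_sq {n a : ℤ}
    (h : pellValue (pellTwentyOne ^ n) = a ^ 2) : n = 0 := by
  by_contra hn
  have hdvd := dvd_of_pellTwentyOne_zpow_eq_sq h
  obtain ⟨s, m, rfl, hm2⟩ := Int.exists_eq_pow_mul_and_not_dvd hn (p := 2) (by norm_num)
  push_cast at hdvd hm2 hn h
  have hs : (4 : ℤ) ∣ 2 ^ s := by
    have h4 : (2 : ℤ) ^ 2 ∣ 2 ^ s * m := by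
      refine Dvd.dvd.trans ?_ hdvd
      norm_num
    exact (IsCoprime.pow_left ((Int.prime_two.coprime_iff_not_dvd).2 hm2)).dvd_of_dvd_mul_right h4
  have h27 : (27 : ℤ) ∣ m := by
    have hd : (27 : ℤ) ∣ 2 ^ s * m := by
      refine Dvd.dvd.trans ?_ hdvd
      norm_num
    have h2 : IsCoprime (27 : ℤ) (2 ^ s) := IsCoprime.pow_right ⟨1, -13, by norm_num⟩
    exact h2.dvd_of_dvd_mul_left hd
  have hs5 : ¬ (5 : ℤ) ∣ 2 ^ s := by
    intro h5
    have := (Int.prime_iff_natAbs_prime.2 (by norm_num)).dvd_of_dvd_pow h5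
    omega
  have key (e : ℤ) (j : ℤ) (he : 2 ^ s * e % 5 = 3) (hj : j % 4 = 1) (hm : m = e * j) :
      False := by
    refine pellTwentyOne_zpow_ne_sq (κ := 2 ^ s * e) (q := j / 4) (a := a) (hs.mul_right _) ?_ ?_
    · have := hs.mul_right e
      omega
    · rw [← h]
      congr 2
      rw [hm]
      have : j = 4 * (j / 4) + 1 := by omega
      linear_combination -(2 ^ s * e) * this
  obtain ⟨c, rfl⟩ := h27
  obtain ⟨K, hK⟩ : ∃ K : ℤ, 2 ^ s = K := ⟨_, rfl⟩
  rw [hK] at key hs5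
  rcases (by omega : 27 * c % 4 = 1 ∨ 27 * c % 4 = 3) with hc | hc <;>
  rcases (by omega : K % 5 = 1 ∨ K % 5 = 2 ∨ K % 5 = 3 ∨ K % 5 = 4) with e | e | e | e
  · exact key (-27) (-c) (by omega) (by omega) (by ring)
  · exact key 9 (3 * c) (by omega) (by omega) (by ring)
  · exact key 1 (27 * c) (by omega) (by omega) (by ring)
  · exact key (-3) (-(9 * c)) (by omega) (by omega) (by ring)
  · exact key 3 (9 * c) (by omega) (by omega) (by ring)
  · exact key (-1) (-(27 * c)) (by omega) (by omega) (by ring)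
  · exact key (-9) (-(3 * c)) (by omega) (by omega) (by ring)
  · exact key 27 c (by omega) (by omega) (by ring)

theorem sq_eq_one_of_five_mul_pow_four {a b : ℤ} (hb : 0 < b)
    (h : 5 * a ^ 4 + 7 = 12 * b ^ 2) : a ^ 2 = 1 := by
  obtain ⟨n, hX, -⟩ := exists_pellValue_of_sol (g := pellFifteen) (p := 5) (q := 7) (t := 31)
    (v := 4) (by norm_num) pellFifteen_x pellFifteen_y (by norm_num) (by norm_num) (by norm_num)
    (by norm_num) (by norm_num) (fun X b hb hX h => by
      rw [abs_lt] at hX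
      obtain ⟨h1, h2⟩ := hX
      interval_cases X <;> first | omega | exact ⟨by norm_num, by nlinarith⟩) b.toNat (a ^ 2) b
    hb (by omega) (by rw [← h]; ring)
  rcases hX with hX | hX
  · have := eq_zero_of_pellFifteen_zpow_eq_sq hX.symm
    rw [this] at hX
    simpa [pellValue] using hX
  · exact absurd (by rw [hX, neg_neg]) (pellFifteen_zpow_ne_neg_sq n a)

theorem sq_eq_one_of_seven_mul_pow_four {a b : ℤ} (hb : 0 < b)
    (h : 7 * a ^ 4 + 5 = 12 * b ^ 2) : a ^ 2 = 1 := by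
  obtain ⟨n, hX, -⟩ := exists_pellValue_of_sol (g := pellTwentyOne) (p := 7) (q := 5) (t := 55)
    (v := 6) (by norm_num) pellTwentyOne_x pellTwentyOne_y (by norm_num) (by norm_num)
    (by norm_num) (by norm_num) (by norm_num) (fun X b hb hX h => by
      rw [abs_lt] at hX
      obtain ⟨h1, h2⟩ := hX
      interval_cases X <;> first | omega | exact ⟨by norm_num, by nlinarith⟩) b.toNat (a ^ 2) b
    hb (by omega) (by rw [← h]; ring)
  rcases hX with hX | hX
  · have := eq_zero_of_pellTwentyOne_zpow_eq_sq hX.symm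
    rw [this] at hX
    simpa [pellValue] using hX
  · exact absurd (by rw [hX, neg_neg]) (pellTwentyOne_zpow_ne_neg_sq n a)

end PellEquation

/-! ### Exponents two and three -/

theorem pow_four_emod_sixteen {a : ℤ} (ha : a % 2 = 1) : a ^ 4 % 16 = 1 := by
  obtain ⟨c, hc⟩ := Int.eight_dvd_sq_sub_one_of_odd (Int.odd_iff.2 ha)
  have : a ^ 4 = 16 * (4 * c ^ 2 + c) + 1 := by linear_combination (a ^ 2 + 8 * c + 1) * hc
  omega

theorem cube_emod_nine (a : ℤ) : a % 3 = 0 ∧ a ^ 3 % 27 = 0 ∨ a % 3 = 1 ∧ a ^ 3 % 9 = 1 ∨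
    a % 3 = 2 ∧ a ^ 3 % 9 = 8 := by
  obtain ⟨c, hc⟩ : ∃ c, a = 3 * c + a % 3 := ⟨a / 3, by omega⟩
  rcases (by omega : a % 3 = 0 ∨ a % 3 = 1 ∨ a % 3 = 2) with e | e | e <;> rw [e] at hc
  · have : a ^ 3 = 27 * c ^ 3 := by rw [hc]; ring
    omega
  · have : a ^ 3 = 9 * (3 * c ^ 3 + 3 * c ^ 2 + c) + 1 := by rw [hc]; ring
    omega
  · have : a ^ 3 = 9 * (3 * c ^ 3 + 6 * c ^ 2 + 4 * c) + 8 := by rw [hc]; ring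
    omega

theorem pow_six_emod_nine (a : ℤ) : a ^ 6 % 9 = 0 ∨ a ^ 6 % 9 = 1 := by
  have h : a ^ 6 = a ^ 3 * a ^ 3 := by ring
  rw [h, Int.mul_emod]
  have := cube_emod_nine a
  rcases (by omega : a ^ 3 % 9 = 0 ∨ a ^ 3 % 9 = 1 ∨ a ^ 3 % 9 = 8) with e | e | e <;>
    rw [e] <;> decide

theorem cube_emod_seven (a : ℤ) : a ^ 3 % 7 = 0 ∨ a ^ 3 % 7 = 1 ∨ a ^ 3 % 7 = 6 := by
  rw [pow_succ, pow_two, Int.mul_emod, Int.mul_emod a a]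
  rcases (by omega : a % 7 = 0 ∨ a % 7 = 1 ∨ a % 7 = 2 ∨ a % 7 = 3 ∨ a % 7 = 4 ∨ a % 7 = 5 ∨
    a % 7 = 6) with e | e | e | e | e | e | e <;> rw [e] <;> decide

theorem cube_add_one_ne_thirtysix_mul_cube {a b : ℤ} : (35 * a ^ 2) ^ 3 + 1 ≠ 36 * b ^ 3 := by
  intro h
  obtain ⟨s, hs⟩ : ∃ s, s = 35 * a ^ 2 := ⟨_, rfl⟩
  rw [← hs] at h
  have hs9 := cube_emod_nine s
  obtain ⟨t, ht⟩ : ∃ t, s = 3 * t - 1 := ⟨(s + 1) / 3, by omega⟩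
  have h1 : t * (3 * t ^ 2 - 3 * t + 1) = 4 * b ^ 3 := by
    rw [ht] at h
    linarith
  have hcop : IsCoprime (2 ^ 2 : ℤ) (3 * t ^ 2 - 3 * t + 1) := by
    refine IsCoprime.pow_left ((Int.prime_two.coprime_iff_not_dvd).2 ?_)
    have : 3 * t ^ 2 - 3 * t + 1 = 3 * (t * (t - 1)) + 1 := by ring
    have := Int.even_mul_pred_self t
    rw [Int.even_iff] at this
    omega
  obtain ⟨c, rfl⟩ : (4 : ℤ) ∣ t := by
    refine hcop.dvd_of_dvd_mul_right ?_
    rw [h1]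
    exact ⟨b ^ 3, by norm_num⟩
  have h2 : c * (48 * c ^ 2 - 12 * c + 1) = b ^ 3 := by linarith
  obtain ⟨e, he⟩ := Int.eq_pow_of_mul_eq_pow_odd_left
    (show IsCoprime c (48 * c ^ 2 - 12 * c + 1) from ⟨12 - 48 * c, 1, by ring⟩)
    (by decide : Odd 3) h2
  have := cube_emod_seven e
  omega

theorem no_solution_of_exponent_two {D A B : ℕ} (hD : D ∈ [1, 3, 5, 7, 15, 21, 35, 105])
    (hA : Odd A) (hDA : D ∣ A) (hDA' : 9 * D ≤ A ^ 2) :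
    4 * D ^ 3 * B ^ 2 ≠ 3 * A ^ (2 * 2) + 105 * D ^ 2 := by
  intro h
  obtain ⟨a, rfl⟩ := hDA
  have hD0 : 0 < D := by
    simp only [List.mem_cons, List.not_mem_nil, or_false] at hD
    omega
  have hdiv : (4 * D * B ^ 2 : ℤ) = 3 * D ^ 2 * a ^ 4 + 105 := by
    have hD2 : ((D : ℤ) ^ 2) ≠ 0 := by positivity
    zify at h
    refine mul_left_cancel₀ hD2 ?_
    linear_combination h
  clear h
  have ha : (a : ℤ) % 2 = 1 := by
    have := Nat.odd_iff.1 (Nat.odd_mul.1 hA).2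
    omega
  have h16 := pow_four_emod_sixteen ha
  have hB3 : (B : ℤ) ^ 2 % 3 = 0 → (B : ℤ) % 3 = 0 := fun h0 =>
    Int.emod_eq_zero_of_dvd (Int.prime_three.dvd_of_dvd_pow (Int.dvd_of_emod_eq_zero h0))
  have hpos {b : ℤ} (hb : (B : ℤ) = 3 * b) (hB : (B : ℤ) ^ 2 ≠ 0) : 0 < b := by
    have : (B : ℤ) ≠ 0 := fun h0 => hB (by rw [h0]; norm_num)
    omega
  have hne (ha1 : (a : ℤ) ^ 2 = 1) : 9 ≤ D := by
    have : a ^ 2 = 1 := by exact_mod_cast ha1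
    rw [mul_pow, this] at hDA'
    nlinarith
  simp only [List.mem_cons, List.not_mem_nil, or_false] at hD
  clear hDA' hA
  rcases hD with rfl | rfl | rfl | rfl | rfl | rfl | rfl | rfl <;> norm_num at hdiv
  · have := sq_emod_four B
    omega
  · have := sq_emod_four B
    omega
  · obtain ⟨b, hb⟩ : ∃ b, (B : ℤ) = 3 * b := ⟨B / 3, by omega⟩
    have := hne (sq_eq_one_of_five_mul_pow_four (hpos hb (by omega)) (b := b)
      (by rw [hb] at hdiv; linarith))
    omega
  · obtain ⟨b, hb⟩ : ∃ b, (B : ℤ) = 3 * b := ⟨B / 3, by omega⟩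
    have := hne (sq_eq_one_of_seven_mul_pow_four (hpos hb (by omega)) (b := b)
      (by rw [hb] at hdiv; linarith))
    omega
  · have := sq_emod_five B
    omega
  · have := sq_emod_seven B
    omega
  · have := sq_emod_four B
    omega
  · have := sq_emod_four B
    omega

set_option maxHeartbeats 1000000 in
theorem no_solution_of_exponent_three {D A B : ℕ} (hD : D ∈ [1, 3, 5, 7, 15, 21, 35, 105])
    (hA1 : 1 < A) (hDA : D ∣ A) : 4 * D ^ 3 * B ^ 3 ≠ 3 * A ^ (2 * 3) + 105 * D ^ 2 := by
  intro h
  obtain ⟨a, rfl⟩ := hDA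
  have hD0 : 0 < D := Nat.pos_of_mul_pos_right (by omega : 0 < D * a)
  have hdiv : (4 * D * B ^ 3 : ℤ) = 3 * D ^ 4 * a ^ 6 + 105 := by
    have hD2 : ((D : ℤ) ^ 2) ≠ 0 := by positivity
    zify at h
    refine mul_left_cancel₀ hD2 ?_
    linear_combination h
  clear h
  have hB9 := cube_emod_nine B
  have ha := pow_six_emod_nine a
  simp only [List.mem_cons, List.not_mem_nil, or_false] at hD
  rcases hD with rfl | rfl | rfl | rfl | rfl | rfl | rfl | rfl <;> norm_num at hdiv
  · obtain ⟨b, hb⟩ : ∃ b, (B : ℤ) = 3 * b := ⟨B / 3, by omega⟩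
    have ha0 : (0 : ℤ) < a := by omega
    have := eq_one_of_cube_add_thirtyfive (s := a ^ 2) (b := b) (by positivity)
      (by rw [hb] at hdiv; linarith)
    nlinarith
  · omega
  · omega
  · omega
  · omega
  · have := cube_emod_seven B
    omega
  · have h4 : (4 * B ^ 3 : ℤ) = 3 * (42875 * a ^ 6 + 1) := by linarith
    clear hdiv ha
    obtain ⟨b, hb⟩ : ∃ b, (B : ℤ) = 3 * b := ⟨B / 3, by omega⟩
    exact cube_add_one_ne_thirtysix_mul_cube (a := a) (b := b) (by rw [hb] at h4; linarith)
  · have h4 : (4 * B ^ 3 : ℤ) = 9 * (385875 * a ^ 6) + 1 := by linarith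
    clear hdiv ha
    omega

/-! ### The main theorem -/

theorem exists_pow_of_mul_eq_pow {l z w Y : ℕ} (hz : Odd z) (hz9 : 9 ≤ z) (hw : Odd w)
    (hzw : 4 * w = z ^ 2 + 35) (hY : 3 * z * w = Y ^ l) (hl : l ≠ 0) :
    ∃ D A B : ℕ, D ∈ [1, 3, 5, 7, 15, 21, 35, 105] ∧ Odd A ∧ 1 < A ∧ Odd B ∧ D ∣ A ∧
      9 * D ≤ A ^ l ∧ 4 * D ^ 3 * B ^ l = 3 * A ^ (2 * l) + 105 * D ^ 2 := by
  obtain ⟨D, hD⟩ : ∃ D, D = Nat.gcd z 105 := ⟨_, rfl⟩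
  have hDz : D ∣ z := hD ▸ Nat.gcd_dvd_left _ _
  have hD105 : D ∣ 105 := hD ▸ Nat.gcd_dvd_right _ _
  have hsf : Squarefree 105 := by
    rw [show (105 : ℕ) = 3 * (5 * 7) by norm_num, Nat.squarefree_mul (by norm_num),
      Nat.squarefree_mul (by norm_num)]
    exact ⟨Nat.prime_three.squarefree, Nat.prime_five.squarefree, Nat.prime_seven.squarefree⟩
  have hDodd : Odd D := hz.of_dvd_nat hDz
  have hDpos : 0 < D := hDodd.pos
  have hDw : D ∣ 3 * w := by
    have hcop : Nat.Coprime D 4 := by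
      rw [show 4 = 2 ^ 2 by norm_num]
      exact hDodd.coprime_two_right.pow_right 2
    refine hcop.dvd_of_dvd_mul_left ?_
    rw [show 4 * (3 * w) = 3 * z * z + 105 by linarith [sq z]]
    exact dvd_add (hDz.mul_left _) hD105
  obtain ⟨v, hv⟩ := hDw
  have hvodd : Odd v := by
    have : Odd (D * v) := hv ▸ (by decide : Odd 3).mul hw
    exact (Nat.odd_mul.1 this).2
  have hv' : 4 * (D * v) = 3 * z ^ 2 + 105 := by
    rw [← hv]
    linarith
  have hcop : Nat.Coprime (z * D) v := by
    refine Nat.coprime_of_dvd fun p hp hpz hpv => ?_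
    have hpz : p ∣ z := (hp.dvd_mul.1 hpz).elim id fun h => h.trans hDz
    have hpp : p * p ∣ 3 * z ^ 2 := by
      rw [sq]
      exact (mul_dvd_mul hpz hpz).mul_left 3
    have hp105 : p ∣ 105 := by
      refine (Nat.dvd_add_right ((dvd_mul_right p p).trans hpp)).1 ?_
      rw [← hv']
      exact (hpv.mul_left _).mul_left _
    have hpD : p ∣ D := hD ▸ Nat.dvd_gcd hpz hp105
    have : p * p ∣ 105 := by
      refine (Nat.dvd_add_right hpp).1 ?_
      rw [← hv']
      exact (mul_dvd_mul hpD hpv).mul_left _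
    exact hp.one_lt.ne' (Nat.isUnit_iff.1 (hsf p this))
  have hmul : z * D * v = Y ^ l := by
    rw [← hY, mul_assoc, ← hv]
    ring
  obtain ⟨A, hA⟩ := exists_eq_pow_of_mul_eq_pow (Nat.isUnit_iff.2 hcop) hmul
  obtain ⟨B, hB⟩ := exists_eq_pow_of_mul_eq_pow (Nat.isUnit_iff.2 hcop.symm)
    ((mul_comm _ _).trans hmul)
  have hAodd : Odd A := by
    rw [← Nat.odd_pow_iff hl, ← hA]
    exact hz.mul hDodd
  refine ⟨D, A, B, ?_, hAodd, ?_, ?_, ?_, ?_, ?_⟩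
  · have key : ∀ D ∈ Nat.divisors 105, D ∈ [1, 3, 5, 7, 15, 21, 35, 105] := by decide +kernel
    exact key D (Nat.mem_divisors.2 ⟨hD105, by norm_num⟩)
  · refine lt_of_le_of_ne hAodd.pos fun h => ?_
    rw [← h, one_pow] at hA
    nlinarith
  · rwa [← Nat.odd_pow_iff hl, ← hB]
  · exact (hsf.squarefree_of_dvd hD105).isRadical l A (hA ▸ dvd_mul_left _ _)
  · rw [← hA]
    exact Nat.mul_le_mul_right _ hz9
  · rw [← hB, mul_comm 2 l, pow_mul, ← hA]
    linear_combination D ^ 2 * hv'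

theorem no_solution_of_prime_exponent {l D A B : ℕ} (hl : l.Prime)
    (hD : D ∈ [1, 3, 5, 7, 15, 21, 35, 105]) (hA : Odd A) (hA1 : 1 < A) (hB : Odd B)
    (hDA : D ∣ A) (hDA' : 9 * D ≤ A ^ l) :
    4 * D ^ 3 * B ^ l ≠ 3 * A ^ (2 * l) + 105 * D ^ 2 := by
  have hD' : 0 < D ∧ D ≤ 105 := by
    simp only [List.mem_cons, List.not_mem_nil, or_false] at hD
    omega
  rcases lt_or_ge l 11 with h11 | h11
  · have : l = 2 ∨ l = 3 ∨ l = 5 ∨ l = 7 := by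
      revert hl
      interval_cases l <;> norm_num
    rcases this with rfl | rfl | hl57
    · exact no_solution_of_exponent_two hD hA hDA hDA'
    · exact no_solution_of_exponent_three hD hA1 hDA
    · by_cases h3 : D = 3
      · rw [h3]
        exact no_solution_of_gcd_three hl57 hA
      by_cases h7 : D = 7
      · rw [h7]
        exact no_solution_of_gcd_seven hl57
      refine no_solution_of_exponent_five_or_seven hl57 ?_ A B
      simp only [List.mem_cons, List.not_mem_nil] at hD ⊢
      tauto
  rcases lt_or_ge l 9011 with h9011 | h9011
  · exact no_solution_of_moderate_exponent hl h11 h9011 hD A B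
  obtain ⟨m, rfl⟩ := hl.odd_of_ne_two (by omega)
  exact no_solution_of_large_exponent hD'.1 hD'.2 (by omega) hA hA1 hB

/-- No perfect prime power is a sum of six consecutive cubes of positive integers:
there are no integers `x ≥ 1` and `y` with
`(x+1)³ + (x+2)³ + (x+3)³ + (x+4)³ + (x+5)³ + (x+6)³ = yˡ`, `ℓ` prime. -/
theorem sum_six_consecutive_cubes_not_perfect_power (ℓ : ℕ) (hℓ : ℓ.Prime) :
    ¬ ∃ (x y : ℤ), 1 ≤ x ∧
      (x + 1) ^ 3 + (x + 2) ^ 3 + (x + 3) ^ 3 + (x + 4) ^ 3 + (x + 5) ^ 3 + (x + 6) ^ 3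
        = y ^ ℓ := by
  rintro ⟨x, y, hx, h⟩
  lift x to ℕ using by omega
  have hY : 3 * (2 * x + 7) * (x ^ 2 + 7 * x + 21) = y.natAbs ^ ℓ := by
    rw [← Int.natAbs_pow, ← h]
    zify
    rw [abs_of_nonneg (by positivity)]
    ring
  have hw : Odd (x ^ 2 + 7 * x + 21) := by
    rw [show x ^ 2 + 7 * x + 21 = x * (x + 1) + 2 * (3 * x + 10) + 1 by ring]
    exact ((Nat.even_mul_succ_self x).add (even_two_mul _)).add_one
  obtain ⟨D, A, B, hD, hA, hA1, hB, hDA, hDA', heq⟩ := exists_pow_of_mul_eq_pow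
    (z := 2 * x + 7) ⟨x + 3, by ring⟩ (by omega) hw (by ring) hY hℓ.ne_zero
  exact no_solution_of_prime_exponent hℓ hD hA hA1 hB hDA hDA' heq
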